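/- arXiv:2111.03531 — 7 statements merged into one kernel-verified Lean document; each statement's English description precedes it below -/
import Mathlib

section
/- Define h : ℤ × ℤ → ℕ by h(p,q) = Σ_{m ∈ {1,…,ℓ}^{s+1}} Σ_{n ∈ {1,…,ℓ}^{r+1}} |Ψ_{(m,n)}(p,q)| · D(m,n). Then there exists a polynomial P ∈ ℚ[X,Y] such that h(p,q) = P(p,q) for all integers p, q with p ≥ i^0_ℓ + ⋯ + i^s_ℓ − a_1·j^1_1 − ⋯ − a_r·j^r_1 − 1 and q ≥ j^0_ℓ + ⋯ + j^r_ℓ − 1. (This is the combinatorial content of the paper's main Theorem: by Klyachko's description, h is the multigraded Hilbert function of the B-saturation of a rank-ℓ multigraded reflexive module over the Cox ring of ℙ(O_{ℙ^s} ⊕ O_{ℙ^s}(a_1) ⊕ ⋯ ⊕ O_{ℙ^s}(a_r)), so the Hilbert function agrees with a polynomial on this region.) -/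
open scoped BigOperators

/-- `f` vanishes at all sufficiently negative integers. -/
def VanishesBelow (f : ℤ → ℚ) : Prop := ∃ L : ℤ, ∀ x < L, f x = 0

/-- `f` agrees with a polynomial on `[M, ∞)`, expressed through iterated forward differences. -/
def PolynomialFrom (M : ℤ) (f : ℤ → ℚ) : Prop := ∃ k : ℕ, ∀ n, M ≤ n → (fwdDiff 1)^[k] f n = 0

/-- The convolution of two functions on `ℤ`. -/
noncomputable def intConv (f g : ℤ → ℚ) (n : ℤ) : ℚ := ∑ᶠ k, f k * g (n - k)

theorem VanishesBelow.fwdDiff {f : ℤ → ℚ} (hf : VanishesBelow f) :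
    VanishesBelow (fwdDiff 1 f) := by
  obtain ⟨L, hL⟩ := hf
  refine ⟨L - 1, fun x hx => ?_⟩
  simp [_root_.fwdDiff, hL x (by omega), hL (x + 1) (by omega)]

theorem VanishesBelow.mul_right {f : ℤ → ℚ} (hf : VanishesBelow f) (g : ℤ → ℚ) :
    VanishesBelow (fun x => f x * g x) := by
  obtain ⟨L, hL⟩ := hf
  exact ⟨L, fun x hx => by simp [hL x hx]⟩

theorem VanishesBelow.finite_support {f g : ℤ → ℚ} (hf : VanishesBelow f) (hg : VanishesBelow g)
    (n : ℤ) : Function.HasFiniteSupport (fun k => f k * g (n - k)) := by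
  obtain ⟨L, hL⟩ := hf
  obtain ⟨L', hL'⟩ := hg
  refine (Set.finite_Icc L (n - L')).subset fun k hk => ?_
  have hk : f k * g (n - k) ≠ 0 := hk
  constructor
  · by_contra h
    exact hk (by simp [hL k (by omega)])
  · by_contra h
    exact hk (by simp [hL' (n - k) (by omega)])

theorem VanishesBelow.intConv {f g : ℤ → ℚ} (hf : VanishesBelow f) (hg : VanishesBelow g) :
    VanishesBelow (intConv f g) := by
  obtain ⟨L, hL⟩ := hf
  obtain ⟨L', hL'⟩ := hg
  refine ⟨L + L', fun n hn => ?_⟩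
  rw [_root_.intConv, finsum_eq_zero_of_forall_eq_zero]
  intro k
  rcases lt_or_ge k L with h | h
  · simp [hL k h]
  · simp [hL' (n - k) (by omega)]

theorem fwdDiff_intConv_right {f g : ℤ → ℚ} (hf : VanishesBelow f) (hg : VanishesBelow g) :
    fwdDiff 1 (intConv f g) = intConv f (fwdDiff 1 g) := by
  funext n
  simp only [fwdDiff, intConv]
  rw [← finsum_sub_distrib (hf.finite_support hg _) (hf.finite_support hg _)]
  refine finsum_congr fun k => ?_
  rw [show n + 1 - k = n - k + 1 by ring]
  ring

theorem intConv_comm (f g : ℤ → ℚ) : intConv f g = intConv g f := by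
  funext n
  rw [intConv, intConv, ← finsum_comp_equiv (Equiv.subLeft n)]
  refine finsum_congr fun k => ?_
  simp [mul_comm]

theorem fwdDiff_iter_intConv_right {f : ℤ → ℚ} (hf : VanishesBelow f) (k : ℕ) :
    ∀ {g : ℤ → ℚ}, VanishesBelow g →
      (fwdDiff 1)^[k] (intConv f g) = intConv f ((fwdDiff 1)^[k] g) := by
  induction k with
  | zero => intro g _; rfl
  | succ k ih =>
    intro g hg
    rw [Function.iterate_succ_apply, Function.iterate_succ_apply, fwdDiff_intConv_right hf hg,
      ih hg.fwdDiff]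

theorem VanishesBelow.fwdDiff_iter {f : ℤ → ℚ} (hf : VanishesBelow f) (k : ℕ) :
    VanishesBelow ((_root_.fwdDiff 1)^[k] f) := by
  induction k with
  | zero => exact hf
  | succ k ih => rw [Function.iterate_succ_apply']; exact ih.fwdDiff

/-- The convolution of functions that are polynomial on `[M, ∞)` and on `[N, ∞)` is polynomial on
`[M + N - 1, ∞)`. -/
theorem PolynomialFrom.intConv {f g : ℤ → ℚ} {M N : ℤ} (hf : VanishesBelow f)
    (hg : VanishesBelow g) (hfM : PolynomialFrom M f) (hgN : PolynomialFrom N g) :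
    PolynomialFrom (M + N - 1) (intConv f g) := by
  obtain ⟨k, hk⟩ := hfM
  obtain ⟨l, hl⟩ := hgN
  refine ⟨k + l, fun n hn => ?_⟩
  rw [Function.iterate_add_apply, fwdDiff_iter_intConv_right hf l hg, intConv_comm,
    fwdDiff_iter_intConv_right (hg.fwdDiff_iter l) k hf, _root_.intConv,
    finsum_eq_zero_of_forall_eq_zero]
  intro x
  rcases lt_or_ge x N with h | h
  · rw [hk (n - x) (by omega), mul_zero]
  · rw [hl x h, zero_mul]

theorem fwdDiff_iter_eq_zero_of_le {f : ℤ → ℚ} {M : ℤ} {k l : ℕ} (hkl : k ≤ l)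
    (hk : ∀ n, M ≤ n → (fwdDiff 1)^[k] f n = 0) (n : ℤ) (hn : M ≤ n) :
    (fwdDiff 1)^[l] f n = 0 := by
  induction l, hkl using Nat.le_induction generalizing n with
  | base => exact hk n hn
  | succ l _ ih =>
    rw [Function.iterate_succ_apply', fwdDiff, ih n hn, ih (n + 1) (by omega), sub_zero]

theorem polynomialFrom_iff {M : ℤ} {f : ℤ → ℚ} :
    PolynomialFrom M f ↔ ∃ P : Polynomial ℚ, ∀ n : ℤ, M ≤ n → f n = P.eval (n : ℚ) := by
  constructor
  · rintro ⟨K, hK⟩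
    refine ⟨∑ k ∈ Finset.range K, Polynomial.C ((fwdDiff 1)^[k] f M / (k.factorial : ℚ)) *
      (descPochhammer ℚ k).comp (Polynomial.X - Polynomial.C (M : ℚ)), fun n hn => ?_⟩
    obtain ⟨N, hN⟩ := Int.eq_ofNat_of_zero_le (sub_nonneg.2 hn)
    obtain rfl : n = M + N := by omega
    have key : ∀ k, ((fwdDiff 1)^[k] f M / (k.factorial : ℚ)) *
        (descPochhammer ℚ k).eval (((M + N : ℤ) : ℚ) - M) = N.choose k • (fwdDiff 1)^[k] f M := by
      intro k
      have hfac : (k.factorial : ℚ) ≠ 0 := by positivity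
      rw [show (((M + N : ℤ) : ℚ) - M) = (N : ℚ) by push_cast; ring,
        descPochhammer_eval_eq_descFactorial, Nat.descFactorial_eq_factorial_mul_choose,
        nsmul_eq_mul]
      push_cast
      field_simp
    rw [Polynomial.eval_finsetSum]
    simp only [Polynomial.eval_mul, Polynomial.eval_C, Polynomial.eval_comp, Polynomial.eval_sub,
      Polynomial.eval_X, key]
    have h := shift_eq_sum_fwdDiff_iter (1 : ℤ) f N M
    rw [nsmul_one] at h
    rw [h, Finset.sum_subset (Finset.range_subset_range.2 (le_max_left (N + 1) K)),
      Finset.sum_subset (Finset.range_subset_range.2 (le_max_right (N + 1) K))]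
    · intro k _ hk
      rw [fwdDiff_iter_eq_zero_of_le (by simpa using hk) hK M le_rfl, smul_zero]
    · intro k _ hk
      rw [Nat.choose_eq_zero_of_lt (by simpa using hk), zero_smul]
  · rintro ⟨P, hP⟩
    refine ⟨P.natDegree + 1, fun n hn => ?_⟩
    have h := congrFun P.fwdDiff_iter_degree_add_one_eq_zero (n : ℚ)
    rw [fwdDiff_iter_eq_sum_shift] at h ⊢
    rw [Pi.zero_apply] at h
    rw [← h]
    refine Finset.sum_congr rfl fun k _ => ?_
    rw [hP _ (by simp; omega)]
    push_cast
    simp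

theorem finite_setOf_le_and_sum_le {s : ℕ} (L : Fin s → ℤ) (C : ℤ) :
    {d : Fin s → ℤ | (∀ t, L t ≤ d t) ∧ ∑ t, d t ≤ C}.Finite := by
  refine (Set.finite_Icc L fun t => C - ∑ t', L t' + L t).subset fun d hd => ⟨hd.1, fun t => ?_⟩
  have h := Finset.single_le_sum (f := fun t => d t - L t) (fun t _ => sub_nonneg.2 (hd.1 t))
    (Finset.mem_univ t)
  have := hd.2
  simp only [Finset.sum_sub_distrib] at h
  simp only
  omega

/-- The sum of `g (n - ∑ d_t) ∏ f_t (d_t)` over all integer vectors `d`. -/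
noncomputable def multiConv {s : ℕ} (g : ℤ → ℚ) (f : Fin s → ℤ → ℚ) (n : ℤ) : ℚ :=
  ∑ᶠ d : Fin s → ℤ, g (n - ∑ t, d t) * ∏ t, f t (d t)

theorem multiConv_finite_support {s : ℕ} {g : ℤ → ℚ} {f : Fin s → ℤ → ℚ} (hg : VanishesBelow g)
    (hf : ∀ t, VanishesBelow (f t)) (n : ℤ) :
    Function.HasFiniteSupport (fun d : Fin s → ℤ => g (n - ∑ t, d t) * ∏ t, f t (d t)) := by
  obtain ⟨L, hL⟩ := hg
  choose L' hL' using hf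
  refine (finite_setOf_le_and_sum_le L' (n - L)).subset fun d hd => ?_
  have hd : g (n - ∑ t, d t) * ∏ t, f t (d t) ≠ 0 := hd
  refine ⟨fun t => ?_, ?_⟩ <;> by_contra h
  · exact hd (by rw [Finset.prod_eq_zero (Finset.mem_univ t) (hL' t _ (by omega)), mul_zero])
  · exact hd (by rw [hL _ (by omega), zero_mul])

theorem multiConv_succ {s : ℕ} {g : ℤ → ℚ} {f : Fin (s + 1) → ℤ → ℚ} (hg : VanishesBelow g)
    (hf : ∀ t, VanishesBelow (f t)) :
    multiConv g f = intConv (f 0) (multiConv g fun t => f t.succ) := by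
  funext n
  rw [multiConv, ← finsum_comp_equiv (Fin.consEquiv fun _ => ℤ), finsum_curry]
  · refine finsum_congr fun x => ?_
    rw [multiConv, mul_finsum]
    refine finsum_congr fun d => ?_
    simp only [Fin.consEquiv_apply, Fin.sum_univ_succ, Fin.prod_univ_succ, Fin.cons_zero,
      Fin.cons_succ, sub_sub]
    ring
  · exact (multiConv_finite_support hg hf n).preimage (Equiv.injective _).injOn

theorem multiConv_vanishesBelow_and_polynomialFrom {s : ℕ} {g : ℤ → ℚ} {M : ℤ}
    (hg : VanishesBelow g) (hgM : PolynomialFrom M g) (f : Fin s → ℤ → ℚ) (N : Fin s → ℤ)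
    (hf : ∀ t, VanishesBelow (f t)) (hfN : ∀ t, PolynomialFrom (N t) (f t)) :
    VanishesBelow (multiConv g f) ∧ PolynomialFrom (M + ∑ t, N t - s) (multiConv g f) := by
  induction s with
  | zero =>
    have h : multiConv g f = g := by
      funext n
      simp [multiConv, finsum_unique]
    simpa [h] using ⟨hg, hgM⟩
  | succ s ih =>
    obtain ⟨h1, h2⟩ := ih (fun t => f t.succ) (fun t => N t.succ) (fun t => hf t.succ)
      fun t => hfN t.succ
    rw [multiConv_succ hg hf]
    refine ⟨(hf 0).intConv h1, ?_⟩
    convert (hfN 0).intConv (hf 0) h1 h2 using 1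
    rw [Fin.sum_univ_succ]
    push_cast
    ring

open Classical in
/-- The indicator function of `[lo, hi)` if `b` holds, and of `[lo, ∞)` otherwise. -/
noncomputable def slotIndicator (b : Prop) (lo hi x : ℤ) : ℚ :=
  if lo ≤ x ∧ (b → x < hi) then 1 else 0

theorem slotIndicator_vanishesBelow (b : Prop) (lo hi : ℤ) :
    VanishesBelow (slotIndicator b lo hi) :=
  ⟨lo, fun x hx => if_neg fun h => by omega⟩

theorem slotIndicator_mul_pow_polynomialFrom {b : Prop} {lo hi M : ℤ} (hlo : lo ≤ M)
    (hhi : b → hi ≤ M) (e : ℕ) :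
    PolynomialFrom M (fun x => slotIndicator b lo hi x * (x : ℚ) ^ e) := by
  rw [polynomialFrom_iff]
  by_cases hb : b
  · refine ⟨0, fun n hn => ?_⟩
    have := hhi hb
    rw [slotIndicator, if_neg fun h => by have := h.2 hb; omega]
    simp
  · refine ⟨Polynomial.X ^ e, fun n hn => ?_⟩
    rw [slotIndicator, if_pos ⟨by omega, fun h => absurd h hb⟩]
    simp

theorem slotIndicator_polynomialFrom {b : Prop} {lo hi M : ℤ} (hlo : lo ≤ M)
    (hhi : b → hi ≤ M) : PolynomialFrom M (slotIndicator b lo hi) := by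
  simpa using slotIndicator_mul_pow_polynomialFrom hlo hhi 0

/-- The vector `d`, completed by the coordinate `n - ∑ d_t` at index `0`, lies in the product of
the intervals `[lo_t, hi_t)`, where the upper bound is dropped when `b_t` fails. -/
def InCell {s : ℕ} (b : Fin (s + 1) → Prop) (lo hi : Fin (s + 1) → ℤ) (n : ℤ) (d : Fin s → ℤ) :
    Prop :=
  (∑ t, d t) ≤ n - lo 0 ∧ (b 0 → n - hi 0 < ∑ t, d t) ∧
    ∀ t : Fin s, lo t.succ ≤ d t ∧ (b t.succ → d t < hi t.succ)

theorem finite_setOf_inCell {s : ℕ} (b : Fin (s + 1) → Prop) (lo hi : Fin (s + 1) → ℤ) (n : ℤ) :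
    {d | InCell b lo hi n d}.Finite :=
  (finite_setOf_le_and_sum_le (fun t => lo t.succ) (n - lo 0)).subset
    fun _ hd => ⟨fun t => (hd.2.2 t).1, hd.1⟩

open Classical in
theorem ite_inCell_eq {s : ℕ} (b : Fin (s + 1) → Prop) (lo hi : Fin (s + 1) → ℤ) (n : ℤ)
    (d : Fin s → ℤ) :
    (if InCell b lo hi n d then 1 else 0 : ℚ) =
      slotIndicator (b 0) (lo 0) (hi 0) (n - ∑ t, d t) *
        ∏ t, slotIndicator (b t.succ) (lo t.succ) (hi t.succ) (d t) := by
  simp only [slotIndicator]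
  rw [Finset.prod_ite_zero, ite_zero_mul_ite_zero]
  simp only [Finset.prod_const_one, mul_one, Finset.mem_univ, true_implies]
  refine if_congr ?_ rfl rfl
  rw [InCell, ← and_assoc]
  refine and_congr_left fun _ => and_congr (by omega) ?_
  exact forall_congr' fun _ => by omega

open Classical in
theorem Set.Finite.cast_ncard_eq_finsum {α : Type*} {S : Set α} (hS : S.Finite) :
    (S.ncard : ℚ) = ∑ᶠ x, if x ∈ S then 1 else 0 := by
  rw [finsum_eq_sum_of_support_subset (s := hS.toFinset) _ (by intro x hx; simpa using hx),
    Set.ncard_eq_toFinset_card S hS, Finset.sum_congr rfl fun x hx => if_pos (by simpa using hx)]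
  simp

theorem ncard_inCell_eq_multiConv {s : ℕ} (b : Fin (s + 1) → Prop) (lo hi : Fin (s + 1) → ℤ)
    (n : ℤ) :
    ({d | InCell b lo hi n d}.ncard : ℚ) =
      multiConv (slotIndicator (b 0) (lo 0) (hi 0))
        (fun t => slotIndicator (b t.succ) (lo t.succ) (hi t.succ)) n := by
  rw [(finite_setOf_inCell b lo hi n).cast_ncard_eq_finsum, multiConv]
  exact finsum_congr fun d => by rw [← ite_inCell_eq]; rfl

open Classical in
theorem ncard_inCell_fibration {s r : ℕ} (b : Fin (s + 1) → Prop) (lo hi : Fin (s + 1) → ℤ)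
    (b' : Fin (r + 1) → Prop) (lo' hi' : Fin (r + 1) → ℤ) (A : (Fin r → ℤ) → ℤ) (q : ℤ) :
    ({dc : (Fin s → ℤ) × (Fin r → ℤ) |
        InCell b' lo' hi' q dc.2 ∧ InCell b lo hi (A dc.2) dc.1}.ncard : ℚ) =
      ∑ᶠ c, (if InCell b' lo' hi' q c then 1 else 0 : ℚ) *
        ({d | InCell b lo hi (A c) d}.ncard : ℚ) := by
  have hfin : {dc : (Fin s → ℤ) × (Fin r → ℤ) |
      InCell b' lo' hi' q dc.2 ∧ InCell b lo hi (A dc.2) dc.1}.Finite := by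
    refine Set.Finite.of_finite_fibers Prod.snd
      ((finite_setOf_inCell b' lo' hi' q).subset ?_) fun c _ => ?_
    · rintro _ ⟨dc, hdc, rfl⟩
      exact hdc.1
    · refine ((finite_setOf_inCell b lo hi (A c)).prod (Set.finite_singleton c)).subset ?_
      rintro ⟨d, _⟩ ⟨hdc, rfl⟩
      exact ⟨hdc.2, rfl⟩
  rw [hfin.cast_ncard_eq_finsum, ← finsum_comp_equiv (Equiv.prodComm (Fin r → ℤ) (Fin s → ℤ)),
    finsum_curry]
  · refine finsum_congr fun c => ?_
    rw [(finite_setOf_inCell b lo hi (A c)).cast_ncard_eq_finsum, mul_finsum]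
    refine finsum_congr fun d => ?_
    rw [ite_zero_mul_ite_zero, mul_one]
    congr 1
  · refine (hfin.preimage (Equiv.injective (Equiv.prodComm (Fin r → ℤ) (Fin s → ℤ))).injOn).subset
      fun x hx => ?_
    by_contra h
    exact hx (if_neg h)

/-- A polynomial in `p + ∑ a_u c_u`, as a sum of monomials in `p` and the `c_u`. -/
theorem exists_monomial_expansion {r : ℕ} (a : Fin r → ℤ) (Q : Polynomial ℚ) :
    ∃ T : MvPolynomial (Fin (r + 1)) ℚ, ∀ (p : ℤ) (c : Fin r → ℤ),
      Q.eval (((p + ∑ u, a u * c u : ℤ)) : ℚ) =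
        ∑ e ∈ T.support, T.coeff e * ((p : ℚ) ^ e 0 * ∏ u, (c u : ℚ) ^ e u.succ) := by
  refine ⟨Polynomial.aeval (MvPolynomial.X 0 +
    ∑ u, MvPolynomial.C (a u : ℚ) * MvPolynomial.X (Fin.succ u)) Q, fun p c => ?_⟩
  have h := MvPolynomial.eval_eq' (Fin.cons (p : ℚ) fun u => (c u : ℚ))
    (Polynomial.aeval (MvPolynomial.X 0 +
      ∑ u, MvPolynomial.C (a u : ℚ) * MvPolynomial.X (Fin.succ u)) Q)
  simp only [Fin.prod_univ_succ, Fin.cons_zero, Fin.cons_succ] at h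
  rw [← h, ← MvPolynomial.coe_aeval_eq_eval, RingHom.coe_coe, ← Polynomial.aeval_algHom_apply,
    ← Polynomial.coe_aeval_eq_eval]
  simp

open Classical in
/-- The number of lattice points in a twisted product of two cells is a polynomial in `(p, q)`
on an explicit region. -/
theorem exists_polynomial_ncard_inCell {s r : ℕ} (hs : 1 ≤ s) (hr : 1 ≤ r) (a : Fin r → ℤ)
    (ha : ∀ u, 0 ≤ a u) {b : Fin (s + 1) → Prop} {lo hi M : Fin (s + 1) → ℤ}
    (hlo : ∀ t, lo t ≤ M t) (hhi : ∀ t, b t → hi t ≤ M t)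
    {b' : Fin (r + 1) → Prop} {lo' hi' M' : Fin (r + 1) → ℤ}
    (hlo' : ∀ u, lo' u ≤ M' u) (hhi' : ∀ u, b' u → hi' u ≤ M' u) :
    ∃ P : MvPolynomial (Fin 2) ℚ, ∀ p q : ℤ,
      (∑ t, M t) - (∑ u : Fin r, a u * lo' u.succ) - 1 ≤ p → (∑ u, M' u) - 1 ≤ q →
      ({dc : (Fin s → ℤ) × (Fin r → ℤ) | InCell b' lo' hi' q dc.2 ∧
        InCell b lo hi (p + ∑ u, a u * dc.2 u) dc.1}.ncard : ℚ) =
        MvPolynomial.eval ![(p : ℚ), (q : ℚ)] P := by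
  obtain ⟨Q, hQ⟩ := polynomialFrom_iff.1
    (multiConv_vanishesBelow_and_polynomialFrom (slotIndicator_vanishesBelow (b 0) (lo 0) (hi 0))
      (slotIndicator_polynomialFrom (hlo 0) (hhi 0))
      (fun t : Fin s => slotIndicator (b t.succ) (lo t.succ) (hi t.succ)) (fun t => M t.succ)
      (fun t => slotIndicator_vanishesBelow _ _ _)
      fun t => slotIndicator_polynomialFrom (hlo _) (hhi _)).2
  obtain ⟨T, hT⟩ := exists_monomial_expansion a Q
  have hvan (e : Fin (r + 1) →₀ ℕ) (u : Fin r) : VanishesBelow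
      (fun x => slotIndicator (b' u.succ) (lo' u.succ) (hi' u.succ) x * (x : ℚ) ^ e u.succ) :=
    (slotIndicator_vanishesBelow _ _ _).mul_right _
  have hR (e : Fin (r + 1) →₀ ℕ) := polynomialFrom_iff.1
    (multiConv_vanishesBelow_and_polynomialFrom
      (slotIndicator_vanishesBelow (b' 0) (lo' 0) (hi' 0))
      (slotIndicator_polynomialFrom (hlo' 0) (hhi' 0)) _ (fun u => M' u.succ) (hvan e)
      fun u => slotIndicator_mul_pow_polynomialFrom (hlo' _) (hhi' _) _).2
  choose R hR using hR
  refine ⟨∑ e ∈ T.support, MvPolynomial.C (T.coeff e) *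
    (MvPolynomial.X 0 ^ e 0 * Polynomial.aeval (MvPolynomial.X 1) (R e)), fun p q hp hq => ?_⟩
  rw [Fin.sum_univ_succ] at hp hq
  rw [ncard_inCell_fibration (A := fun c => p + ∑ u, a u * c u)]
  have hterm (c : Fin r → ℤ) : (if InCell b' lo' hi' q c then 1 else 0 : ℚ) *
      ({d | InCell b lo hi (p + ∑ u, a u * c u) d}.ncard : ℚ) =
      ∑ e ∈ T.support, T.coeff e * (p : ℚ) ^ e 0 *
        (slotIndicator (b' 0) (lo' 0) (hi' 0) (q - ∑ u, c u) *
          ∏ u, (slotIndicator (b' u.succ) (lo' u.succ) (hi' u.succ) (c u) *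
            (c u : ℚ) ^ e u.succ)) := by
    have hsplit (e : Fin (r + 1) →₀ ℕ) : T.coeff e * (p : ℚ) ^ e 0 *
        (slotIndicator (b' 0) (lo' 0) (hi' 0) (q - ∑ u, c u) *
          ∏ u, (slotIndicator (b' u.succ) (lo' u.succ) (hi' u.succ) (c u) *
            (c u : ℚ) ^ e u.succ)) =
        (if InCell b' lo' hi' q c then 1 else 0 : ℚ) *
          (T.coeff e * ((p : ℚ) ^ e 0 * ∏ u, (c u : ℚ) ^ e u.succ)) := by
      rw [ite_inCell_eq, Finset.prod_mul_distrib]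
      ring
    rw [Finset.sum_congr rfl fun e _ => hsplit e, ← Finset.mul_sum, ← hT]
    by_cases hc : InCell b' lo' hi' q c
    · have hA : ∑ u : Fin r, a u * lo' u.succ ≤ ∑ u, a u * c u :=
        Finset.sum_le_sum fun u _ => mul_le_mul_of_nonneg_left (hc.2.2 u).1 (ha u)
      rw [ncard_inCell_eq_multiConv, hQ]
      omega
    · simp [hc]
  rw [finsum_congr hterm, finsum_sum_comm]
  · simp only [map_sum, map_mul, map_pow, MvPolynomial.eval_C, MvPolynomial.eval_X]
    refine Finset.sum_congr rfl fun e _ => ?_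
    rw [← mul_finsum]
    have h := hR e q (by omega)
    rw [multiConv] at h
    rw [h, ← MvPolynomial.coe_aeval_eq_eval, RingHom.coe_coe, ← Polynomial.aeval_algHom_apply,
      ← Polynomial.coe_aeval_eq_eval]
    simp [mul_assoc]
  · intro e _
    refine (multiConv_finite_support (slotIndicator_vanishesBelow (b' 0) (lo' 0) (hi' 0))
      (hvan e) q).subset fun c hc => ?_
    exact right_ne_zero_of_mul hc

theorem le_of_forall_le_succ {ℓ : ℕ} {f : ℕ → ℤ} (hf : ∀ x, 1 ≤ x → x < ℓ → f x ≤ f (x + 1))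
    {x y : ℕ} (hx : 1 ≤ x) (hxy : x ≤ y) (hy : y ≤ ℓ) : f x ≤ f y := by
  induction y, hxy using Nat.le_induction with
  | base => exact le_rfl
  | succ y hxy ih => exact (ih (by omega)).trans (hf y (by omega) (by omega))

/-- Theorem 4.9 of the paper, combinatorial form: with
`h(p,q) = ∑_{m ∈ {1,…,ℓ}^{s+1}} ∑_{n ∈ {1,…,ℓ}^{r+1}} |Ψ_{(m,n)}(p,q)| · D(m,n)`,
there is a polynomial `P ∈ ℚ[X,Y]` such that `h(p,q) = P(p,q)` whenever
`p ≥ i^0_ℓ + ⋯ + i^s_ℓ − a_1 j^1_1 − ⋯ − a_r j^r_1 − 1` and `q ≥ j^0_ℓ + ⋯ + j^r_ℓ − 1`.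
Tuples `m ∈ {1,…,ℓ}^{s+1}` are encoded as functions `m' : Fin (s+1) → Fin ℓ` via
`m_t = (m' t) + 1`, and similarly for `n`. -/
theorem stmt_0 (s r ℓ : ℕ) (hs : 1 ≤ s) (hr : 1 ≤ r) (hl : 1 ≤ ℓ)
    (a : Fin r → ℤ) (ha0 : 0 ≤ a ⟨0, by omega⟩) (hamono : Monotone a)
    (i : Fin (s + 1) → ℕ → ℤ) (hi : ∀ t x, 1 ≤ x → x < ℓ → i t x ≤ i t (x + 1))
    (j : Fin (r + 1) → ℕ → ℤ) (hj : ∀ u x, 1 ≤ x → x < ℓ → j u x ≤ j u (x + 1))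
    (F : Fin (s + 1) → ℕ → Submodule ℂ (Fin ℓ → ℂ))
    (hF : ∀ t x, 1 ≤ x → x < ℓ → F t x ≤ F t (x + 1)) (hFtop : ∀ t, F t ℓ = ⊤)
    (G : Fin (r + 1) → ℕ → Submodule ℂ (Fin ℓ → ℂ))
    (hG : ∀ u x, 1 ≤ x → x < ℓ → G u x ≤ G u (x + 1)) (hGtop : ∀ u, G u ℓ = ⊤) :
    ∃ P : MvPolynomial (Fin 2) ℚ,
      ∀ p q : ℤ,
        (∑ t : Fin (s + 1), i t ℓ) - (∑ u : Fin r, a u * j u.succ 1) - 1 ≤ p →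
        (∑ u : Fin (r + 1), j u ℓ) - 1 ≤ q →
        (∑ m' : Fin (s + 1) → Fin ℓ, ∑ n' : Fin (r + 1) → Fin ℓ,
          (({dc : (Fin s → ℤ) × (Fin r → ℤ) |
              ((∑ u, dc.2 u) ≤ q - j 0 ((n' 0 : ℕ) + 1) ∧
               ((n' 0 : ℕ) + 1 < ℓ → q - j 0 ((n' 0 : ℕ) + 1 + 1) < ∑ u, dc.2 u) ∧
               ∀ u : Fin r, j u.succ ((n' u.succ : ℕ) + 1) ≤ dc.2 u ∧
                 ((n' u.succ : ℕ) + 1 < ℓ → dc.2 u < j u.succ ((n' u.succ : ℕ) + 1 + 1))) ∧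
              ((∑ t, dc.1 t) ≤ p + (∑ u, a u * dc.2 u) - i 0 ((m' 0 : ℕ) + 1) ∧
               ((m' 0 : ℕ) + 1 < ℓ →
                 p + (∑ u, a u * dc.2 u) - i 0 ((m' 0 : ℕ) + 1 + 1) < ∑ t, dc.1 t) ∧
               ∀ t : Fin s, i t.succ ((m' t.succ : ℕ) + 1) ≤ dc.1 t ∧
                 ((m' t.succ : ℕ) + 1 < ℓ →
                   dc.1 t < i t.succ ((m' t.succ : ℕ) + 1 + 1)))}.ncard : ℚ) *
            (Module.finrank ℂ
              ↥((⨅ t : Fin (s + 1), F t ((m' t : ℕ) + 1)) ⊓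
                 ⨅ u : Fin (r + 1), G u ((n' u : ℕ) + 1)) : ℚ)))
          = MvPolynomial.eval ![(p : ℚ), (q : ℚ)] P := by
  have ha (u : Fin r) : 0 ≤ a u := ha0.trans (hamono (Fin.mk_le_of_le_val (Nat.zero_le _)))
  have hcell (m : Fin (s + 1) → Fin ℓ) (n : Fin (r + 1) → Fin ℓ) :=
    exists_polynomial_ncard_inCell hs hr a ha
      (b := fun t => (m t : ℕ) + 1 < ℓ) (lo := fun t => i t ((m t : ℕ) + 1))
      (hi := fun t => i t ((m t : ℕ) + 1 + 1)) (M := fun t => i t ℓ)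
      (fun t => le_of_forall_le_succ (hi t) (by omega) (by omega) le_rfl)
      (fun t h => le_of_forall_le_succ (hi t) (by omega) (by omega) le_rfl)
      (b' := fun u => (n u : ℕ) + 1 < ℓ) (lo' := fun u => j u ((n u : ℕ) + 1))
      (hi' := fun u => j u ((n u : ℕ) + 1 + 1)) (M' := fun u => j u ℓ)
      (fun u => le_of_forall_le_succ (hj u) (by omega) (by omega) le_rfl)
      (fun u h => le_of_forall_le_succ (hj u) (by omega) (by omega) le_rfl)
  choose P hP using hcell
  refine ⟨∑ m, ∑ n, P m n * MvPolynomial.C (Module.finrank ℂ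
    ↥((⨅ t : Fin (s + 1), F t ((m t : ℕ) + 1)) ⊓
      ⨅ u : Fin (r + 1), G u ((n u : ℕ) + 1)) : ℚ), fun p q hp hq => ?_⟩
  simp only [map_sum, map_mul, MvPolynomial.eval_C]
  refine Finset.sum_congr rfl fun m _ => Finset.sum_congr rfl fun n _ => ?_
  have hA : ∑ u : Fin r, a u * j u.succ 1 ≤ ∑ u : Fin r, a u * j u.succ ((n u.succ : ℕ) + 1) :=
    Finset.sum_le_sum fun u _ => mul_le_mul_of_nonneg_left
      (le_of_forall_le_succ (hj u.succ) le_rfl (by omega) (n u.succ).isLt) (ha u)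
  rw [← hP m n p q (by omega) hq]
  rfl
end

section
/- Fix tuples m ∈ {1,…,ℓ}^{s+1} and n ∈ {1,…,ℓ}^{r+1}. Then there exists a polynomial Q ∈ ℚ[X,Y] such that Σ_{c ∈ Ψ_n(q)} |Ψ_m(p;c)| = Q(p,q) for all integers p, q with p ≥ i^0_ℓ + ⋯ + i^s_ℓ − a_1·j^1_1 − ⋯ − a_r·j^r_1 − 1 and q ≥ j^0_ℓ + ⋯ + j^r_ℓ − 1. -/
open Polynomial in
/-- Every bivariate polynomial has a polynomial antidifference in its second variable. -/
theorem exists_evalEval_antidifference (B : ℚ[X][X]) :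
    ∃ S : ℚ[X][X], ∀ q x : ℚ,
      S.evalEval q (x + 1) - S.evalEval q x = B.evalEval q x := by
  induction B using Polynomial.induction_on' with
  | add B₁ B₂ h₁ h₂ =>
    obtain ⟨S₁, h₁⟩ := h₁
    obtain ⟨S₂, h₂⟩ := h₂
    refine ⟨S₁ + S₂, fun q x => ?_⟩
    rw [evalEval_add, evalEval_add, evalEval_add, ← h₁, ← h₂]
    ring
  | monomial k b =>
    refine ⟨C b * C (C ((k : ℚ) + 1)⁻¹) * (Polynomial.bernoulli (k + 1)).map C, fun q x => ?_⟩
    have h := Polynomial.bernoulli_eval_one_add (k + 1) x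
    have hk : (k : ℚ) + 1 ≠ 0 := by positivity
    rw [← C_mul_X_pow_eq_monomial]
    simp only [evalEval_mul, evalEval_C, evalEval_pow, evalEval_X, evalEval_map_C, eval_C]
    rw [add_comm x 1, h]
    push_cast
    field_simp
    ring

open Polynomial in
theorem eval_eval_eq_evalEval (S : ℚ[X][X]) (P : ℚ[X]) (q : ℚ) :
    (S.eval P).eval q = S.evalEval q (P.eval q) := by
  induction S using Polynomial.induction_on' with
  | add S₁ S₂ h₁ h₂ => rw [eval_add, eval_add, evalEval_add, h₁, h₂]
  | monomial k b =>
    rw [← C_mul_X_pow_eq_monomial, evalEval_mul, evalEval_C, evalEval_pow, evalEval_X]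
    simp

theorem sum_Ico_int_telescope (f g : ℤ → ℚ) (h : ∀ x, f (x + 1) - f x = g x)
    (a b : ℤ) (hab : a ≤ b) : ∑ x ∈ Finset.Ico a b, g x = f b - f a := by
  induction b, hab using Int.leInduction with
  | base => simp
  | succ b hb ih =>
    rw [← Finset.insert_Ico_right_eq_Ico_add_one hb, Finset.sum_insert (by simp), ih, ← h b]
    ring

open Polynomial in
/-- Sums of `F x * G (q - x)` over an interval with upper end `q - M` are polynomial in `q`. -/
theorem exists_eval_sum_Ico_mul (F G : ℚ[X]) (L M : ℤ) :
    ∃ J : ℚ[X], ∀ q : ℤ, L ≤ q - M →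
      ∑ x ∈ Finset.Ico L (q - M), F.eval (x : ℚ) * G.eval ((q : ℚ) - x) = J.eval (q : ℚ) := by
  have hG : ∀ q x : ℚ, ((G.map (C.comp C)).eval (C X - X : ℚ[X][X])).evalEval q x
      = G.eval (q - x) := by
    intro q x
    induction G using Polynomial.induction_on' with
    | add G₁ G₂ h₁ h₂ => rw [Polynomial.map_add, eval_add, eval_add, evalEval_add, h₁, h₂]
    | monomial k b =>
      rw [map_monomial, eval_monomial, evalEval_mul, evalEval_pow, evalEval_sub, evalEval_C,
        evalEval_X]
      simp
  obtain ⟨S, hS⟩ :=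
    exists_evalEval_antidifference (F.map C * (G.map (C.comp C)).eval (C X - X))
  refine ⟨S.eval (X - C (M : ℚ)) - S.eval (C (L : ℚ)), fun q hq => ?_⟩
  rw [sum_Ico_int_telescope (fun x => S.evalEval (q : ℚ) (x : ℚ)) _ (fun x => ?_) _ _ hq,
    eval_sub, eval_eval_eq_evalEval, eval_eval_eq_evalEval]
  · simp
  · push_cast
    rw [hS, evalEval_mul, evalEval_map_C, hG]

theorem sum_Ico_int_consecutive (f : ℤ → ℚ) {a b c : ℤ} (hab : a ≤ b) (hbc : b ≤ c) :
    ∑ x ∈ Finset.Ico a c, f x = ∑ x ∈ Finset.Ico a b, f x + ∑ x ∈ Finset.Ico b c, f x := by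
  rw [← Finset.Ico_union_Ico_eq_Ico hab hbc,
    Finset.sum_union (Finset.Ico_disjoint_Ico_consecutive a b c)]

/-- `f` vanishes far to the left and agrees with a polynomial on `[L, ∞)`. -/
def IsPolyFrom (L : ℤ) (f : ℤ → ℚ) : Prop :=
  (∃ a : ℤ, ∀ x < a, f x = 0) ∧ ∃ F : Polynomial ℚ, ∀ x : ℤ, L ≤ x → f x = F.eval (x : ℚ)

open Polynomial in
theorem IsPolyFrom.convolution {L M : ℤ} {f g : ℤ → ℚ} (hf : IsPolyFrom L f)
    (hg : IsPolyFrom M g) :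
    IsPolyFrom (L + M - 1) (fun q => ∑ᶠ x : ℤ, f x * g (q - x)) := by
  obtain ⟨⟨a₀, ha₀⟩, F, hF⟩ := hf
  obtain ⟨⟨b₀, hb₀⟩, G, hG⟩ := hg
  obtain ⟨a, haL, ha⟩ : ∃ a ≤ L, ∀ x < a, f x = 0 :=
    ⟨min a₀ L, min_le_right _ _, fun x hx => ha₀ x (lt_of_lt_of_le hx (min_le_left _ _))⟩
  obtain ⟨b, hbM, hb⟩ : ∃ b ≤ M, ∀ x < b, g x = 0 :=
    ⟨min b₀ M, min_le_right _ _, fun x hx => hb₀ x (lt_of_lt_of_le hx (min_le_left _ _))⟩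
  have key : ∀ q : ℤ, ∑ᶠ x : ℤ, f x * g (q - x)
      = ∑ x ∈ Finset.Ico a (q - b + 1), f x * g (q - x) := by
    intro q
    refine finsum_eq_sum_of_support_subset _ fun x hx => ?_
    rw [Function.mem_support] at hx
    rw [Finset.coe_Ico, Set.mem_Ico]
    constructor
    · by_contra! h
      exact hx (by rw [ha x h, zero_mul])
    · by_contra! h
      exact hx (by rw [hb (q - x) (by omega), mul_zero])
  refine ⟨⟨a + b, fun q hq => ?_⟩, ?_⟩
  · simp only [key]
    rw [Finset.Ico_eq_empty (by omega), Finset.sum_empty]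
  obtain ⟨J, hJ⟩ := exists_eval_sum_Ico_mul F G L (M - 1)
  refine ⟨(∑ x ∈ Finset.Ico a L, C (f x) * G.comp (X - C (x : ℚ))) + J
    + ∑ y ∈ Finset.Ico b M, F.comp (X - C (y : ℚ)) * C (g y), fun q hq => ?_⟩
  simp only [key]
  rw [sum_Ico_int_consecutive _ (b := L) haL (by omega),
    sum_Ico_int_consecutive _ (a := L) (b := q - (M - 1)) (by omega) (by omega),
    eval_add, eval_add, eval_finsetSum, eval_finsetSum, ← add_assoc]
  congr 1
  · congr 1
    · refine Finset.sum_congr rfl fun x hx => ?_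
      rw [Finset.mem_Ico] at hx
      rw [hG (q - x) (by omega)]
      simp
    · rw [← hJ q (by omega)]
      refine Finset.sum_congr rfl fun x hx => ?_
      rw [Finset.mem_Ico] at hx
      rw [hF x (by omega), hG (q - x) (by omega)]
      simp
  · refine Finset.sum_bij' (fun x _ => q - x) (fun y _ => q - y) ?_ ?_ ?_ ?_ ?_
    · intro x hx
      rw [Finset.mem_Ico] at hx ⊢
      omega
    · intro x hx
      rw [Finset.mem_Ico] at hx ⊢
      omega
    · intro x _
      ring
    · intro x _
      ring
    · intro x hx
      rw [Finset.mem_Ico] at hx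
      rw [hF x (by omega)]
      simp

/-- The product of shifted weights entering an iterated convolution. -/
def slackProd {k : ℕ} (w : Fin (k + 1) → ℤ → ℚ) (q : ℤ) (c : Fin k → ℤ) : ℚ :=
  w 0 (q - ∑ u, c u) * ∏ u : Fin k, w u.succ (c u)

theorem slackProd_hasFiniteSupport {k : ℕ} (w : Fin (k + 1) → ℤ → ℚ)
    (hw : ∀ u, ∃ a : ℤ, ∀ x < a, w u x = 0) (q : ℤ) :
    Function.HasFiniteSupport (slackProd w q) := by
  choose a ha using hw
  refine (Set.finite_Icc (fun u : Fin k => a u.succ)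
    (fun u : Fin k => q - a 0 - ∑ v : Fin k, a v.succ + a u.succ)).subset fun c hc => ?_
  rw [Function.mem_support, slackProd, mul_ne_zero_iff, Finset.prod_ne_zero_iff] at hc
  have h0 : a 0 ≤ q - ∑ u, c u := by
    by_contra! h
    exact hc.1 (ha 0 _ h)
  have h1 : ∀ u : Fin k, a u.succ ≤ c u := by
    intro u
    by_contra! h
    exact hc.2 u (Finset.mem_univ u) (ha _ _ h)
  refine ⟨h1, fun u => ?_⟩
  have h2 : c u - a u.succ ≤ ∑ v : Fin k, (c v - a v.succ) :=
    Finset.single_le_sum (f := fun v : Fin k => c v - a v.succ)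
      (fun v _ => sub_nonneg.2 (h1 v)) (Finset.mem_univ u)
  rw [Finset.sum_sub_distrib] at h2
  change c u ≤ q - a 0 - ∑ v : Fin k, a v.succ + a u.succ
  linarith

theorem isPolyFrom_finsum_slackProd {k : ℕ} (w : Fin (k + 1) → ℤ → ℚ) (L : Fin (k + 1) → ℤ)
    (hw : ∀ u, IsPolyFrom (L u) (w u)) :
    IsPolyFrom ((∑ u, L u) - k) (fun q => ∑ᶠ c, slackProd w q c) := by
  induction k with
  | zero =>
    have : (fun q => ∑ᶠ c, slackProd w q c) = w 0 := by
      funext q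
      rw [finsum_unique]
      simp [slackProd]
    rw [this]
    simpa using hw 0
  | succ k ih =>
    have h := (hw 1).convolution (ih (fun u => w ((1 : Fin (k + 2)).succAbove u))
      (fun u => L ((1 : Fin (k + 2)).succAbove u)) fun u => hw _)
    have hfun : (fun q => ∑ᶠ c, slackProd w q c) = fun q => ∑ᶠ x : ℤ, w 1 x *
        ∑ᶠ c, slackProd (fun u => w ((1 : Fin (k + 2)).succAbove u)) (q - x) c := by
      funext q
      rw [← finsum_comp_equiv (Fin.consEquiv fun _ => ℤ), finsum_curry]
      · refine finsum_congr fun x => ?_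
        rw [mul_finsum]
        refine finsum_congr fun c => ?_
        simp only [slackProd, Fin.consEquiv_apply, Fin.sum_univ_succ, Fin.prod_univ_succ,
          Fin.cons_zero, Fin.cons_succ]
        rw [sub_sub]
        simp
        ring
      · exact (slackProd_hasFiniteSupport w (fun u => (hw u).1) q).comp_of_injective
          (Fin.consEquiv fun _ => ℤ).injective
    rw [hfun]
    convert h using 1
    rw [Fin.sum_univ_succAbove _ 1]
    push_cast
    ring

/-- The block `[J x, J (x+1))` of a sequence `J`, which for `x = ℓ` is the ray `[J ℓ, ∞)`. -/
def jumpBlock (ℓ : ℕ) (J : ℕ → ℤ) (x : ℕ) : Set ℤ :=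
  {y | J x ≤ y ∧ (x < ℓ → y < J (x + 1))}

theorem le_of_steps {ℓ : ℕ} {J : ℕ → ℤ} (hJ : ∀ x, 1 ≤ x → x < ℓ → J x ≤ J (x + 1))
    {x y : ℕ} (hx : 1 ≤ x) (hxy : x ≤ y) (hy : y ≤ ℓ) : J x ≤ J y := by
  induction y, hxy using Nat.le_induction with
  | base => exact le_rfl
  | succ y hxy ih => exact (ih (by omega)).trans (hJ y (by omega) (by omega))

theorem isPolyFrom_jumpBlock_indicator_pow {ℓ : ℕ} {J : ℕ → ℤ}
    (hJ : ∀ x, 1 ≤ x → x < ℓ → J x ≤ J (x + 1)) {x : ℕ} (hx : 1 ≤ x ∧ x ≤ ℓ) (e : ℕ) :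
    IsPolyFrom (J ℓ) ((jumpBlock ℓ J x).indicator fun y => (y : ℚ) ^ e) := by
  refine ⟨⟨J x, fun y hy => Set.indicator_of_notMem (fun h => ?_) _⟩, ?_⟩
  · exact absurd h.1 (not_le.2 hy)
  rcases hx.2.lt_or_eq with h | rfl
  · refine ⟨0, fun y hy => ?_⟩
    rw [Set.indicator_of_notMem, Polynomial.eval_zero]
    intro hmem
    have := le_of_steps hJ (x := x + 1) (y := ℓ) (by omega) (by omega) le_rfl
    have := hmem.2 h
    omega
  · refine ⟨Polynomial.X ^ e, fun y hy => ?_⟩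
    rw [Set.indicator_of_mem]
    · simp
    · exact ⟨hy, fun h => absurd h (lt_irrefl _)⟩

/-- The tuples `c` with `c u` in the block `n u.succ` of `J u.succ`, such that `q - ∑ c` lies in
the block `n 0` of `J 0`. -/
def jumpSet {k : ℕ} (ℓ : ℕ) (J : Fin (k + 1) → ℕ → ℤ) (n : Fin (k + 1) → ℕ) (q : ℤ) :
    Set (Fin k → ℤ) :=
  {c | (∑ u, c u) ≤ q - J 0 (n 0) ∧
    (n 0 < ℓ → q - J 0 (n 0 + 1) < ∑ u, c u) ∧
    ∀ u : Fin k, J u.succ (n u.succ) ≤ c u ∧ (n u.succ < ℓ → c u < J u.succ (n u.succ + 1))}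

/-- The weights whose `slackProd` is the monomial of exponent `e`, restricted to `jumpSet`. -/
noncomputable def jumpWeight {k : ℕ} (ℓ : ℕ) (J : Fin (k + 1) → ℕ → ℤ) (n : Fin (k + 1) → ℕ)
    (e : Fin k → ℕ) (u : Fin (k + 1)) : ℤ → ℚ :=
  (jumpBlock ℓ (J u) (n u)).indicator fun y => (y : ℚ) ^ (Fin.cons 0 e : Fin (k + 1) → ℕ) u

theorem slackProd_jumpWeight {k : ℕ} (ℓ : ℕ) (J : Fin (k + 1) → ℕ → ℤ) (n : Fin (k + 1) → ℕ)
    (e : Fin k → ℕ) (q : ℤ) :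
    slackProd (jumpWeight ℓ J n e) q
      = (jumpSet ℓ J n q).indicator fun c => ∏ u, (c u : ℚ) ^ e u := by
  funext c
  by_cases hc : c ∈ jumpSet ℓ J n q
  · rw [Set.indicator_of_mem hc, slackProd, jumpWeight, Set.indicator_of_mem]
    · rw [Fin.cons_zero, pow_zero, one_mul]
      refine Finset.prod_congr rfl fun u _ => ?_
      have hu : c u ∈ jumpBlock ℓ (J u.succ) (n u.succ) := hc.2.2 u
      rw [jumpWeight, Set.indicator_of_mem hu, Fin.cons_succ]
    · exact ⟨by linarith [hc.1], fun h => by linarith [hc.2.1 h]⟩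
  · rw [Set.indicator_of_notMem hc, slackProd]
    by_contra h
    rw [← ne_eq, mul_ne_zero_iff, Finset.prod_ne_zero_iff] at h
    have h0 := Set.mem_of_indicator_ne_zero h.1
    have h1 : ∀ u : Fin k, c u ∈ jumpBlock ℓ (J u.succ) (n u.succ) := fun u =>
      Set.mem_of_indicator_ne_zero (h.2 u (Finset.mem_univ u))
    exact hc ⟨by linarith [h0.1], fun hlt => by linarith [h0.2 hlt], h1⟩

section

variable {k ℓ : ℕ} {J : Fin (k + 1) → ℕ → ℤ} {n : Fin (k + 1) → ℕ}

theorem isPolyFrom_jumpWeight (hJ : ∀ u x, 1 ≤ x → x < ℓ → J u x ≤ J u (x + 1))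
    (hn : ∀ u, 1 ≤ n u ∧ n u ≤ ℓ) (e : Fin k → ℕ) (u : Fin (k + 1)) :
    IsPolyFrom (J u ℓ) (jumpWeight ℓ J n e u) :=
  isPolyFrom_jumpBlock_indicator_pow (hJ u) (hn u) _

theorem jumpSet_finite (hJ : ∀ u x, 1 ≤ x → x < ℓ → J u x ≤ J u (x + 1))
    (hn : ∀ u, 1 ≤ n u ∧ n u ≤ ℓ) (q : ℤ) : (jumpSet ℓ J n q).Finite := by
  refine (slackProd_hasFiniteSupport (jumpWeight ℓ J n 0)
    (fun u => (isPolyFrom_jumpWeight hJ hn 0 u).1) q).subset fun c hc => ?_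
  rw [Function.mem_support, slackProd_jumpWeight, Set.indicator_of_mem hc]
  simp

/-- Monomials sum over `jumpSet` to a polynomial in the total, in the stated range. -/
theorem exists_eval_finsum_jumpSet (hk : 1 ≤ k)
    (hJ : ∀ u x, 1 ≤ x → x < ℓ → J u x ≤ J u (x + 1))
    (hn : ∀ u, 1 ≤ n u ∧ n u ≤ ℓ) (e : Fin k → ℕ) :
    ∃ H : Polynomial ℚ, ∀ q : ℤ, (∑ u, J u ℓ) - 1 ≤ q →
      ∑ᶠ c ∈ jumpSet ℓ J n q, ∏ u, (c u : ℚ) ^ e u = H.eval (q : ℚ) := by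
  obtain ⟨H, hH⟩ := (isPolyFrom_finsum_slackProd _ _ (isPolyFrom_jumpWeight hJ hn e)).2
  refine ⟨H, fun q hq => ?_⟩
  rw [← hH q (by omega), finsum_mem_def]
  simp only [slackProd_jumpWeight]

theorem exists_eval_ncard_jumpSet (hk : 1 ≤ k)
    (hJ : ∀ u x, 1 ≤ x → x < ℓ → J u x ≤ J u (x + 1)) (hn : ∀ u, 1 ≤ n u ∧ n u ≤ ℓ) :
    ∃ H : Polynomial ℚ, ∀ q : ℤ, (∑ u, J u ℓ) - 1 ≤ q →
      ((jumpSet ℓ J n q).ncard : ℚ) = H.eval (q : ℚ) := by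
  obtain ⟨H, hH⟩ := exists_eval_finsum_jumpSet hk hJ hn 0
  refine ⟨H, fun q hq => ?_⟩
  have hfin := jumpSet_finite hJ hn q
  rw [← hH q hq, finsum_mem_eq_finite_toFinset_sum _ hfin, Set.ncard_eq_toFinset_card _ hfin]
  simp

/-- Sums over `jumpSet` of a polynomial in `p + ∑ a u * c u` are polynomial in `p` and the
total. -/
theorem exists_eval_finsum_jumpSet_comp (hk : 1 ≤ k)
    (hJ : ∀ u x, 1 ≤ x → x < ℓ → J u x ≤ J u (x + 1))
    (hn : ∀ u, 1 ≤ n u ∧ n u ≤ ℓ) (f : Polynomial ℚ) (a : Fin k → ℤ) :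
    ∃ Q : MvPolynomial (Fin 2) ℚ, ∀ p q : ℤ, (∑ u, J u ℓ) - 1 ≤ q →
      ∑ᶠ c ∈ jumpSet ℓ J n q, f.eval (((p + ∑ u, a u * c u : ℤ)) : ℚ)
        = MvPolynomial.eval ![(p : ℚ), (q : ℚ)] Q := by
  choose H hH using fun e : Fin k →₀ ℕ => exists_eval_finsum_jumpSet hk hJ hn e
  let W : MvPolynomial (Fin k) (Polynomial ℚ) :=
    Polynomial.aeval (MvPolynomial.C Polynomial.X +
      ∑ u, MvPolynomial.C (Polynomial.C (a u : ℚ)) * MvPolynomial.X u) f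
  have hW : ∀ (p : ℤ) (c : Fin k → ℤ), f.eval (((p + ∑ u, a u * c u : ℤ)) : ℚ)
      = ∑ e ∈ W.support, (W.coeff e).eval (p : ℚ) * ∏ u, (c u : ℚ) ^ e u := by
    intro p c
    have h := MvPolynomial.eval₂_eq' (Polynomial.evalRingHom (p : ℚ)) (fun u => (c u : ℚ)) W
    simp only [Polynomial.coe_evalRingHom] at h
    rw [← h, ← MvPolynomial.coe_eval₂Hom]
    simp only [W]
    rw [Polynomial.aeval_def, Polynomial.hom_eval₂, Polynomial.eval]
    congr 1
    · exact RingHom.ext_rat _ _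
    · simp only [map_add, map_sum, map_mul, MvPolynomial.eval₂Hom_C, MvPolynomial.eval₂Hom_X',
        Polynomial.coe_evalRingHom, Polynomial.eval_X, Polynomial.eval_C]
      push_cast
      rfl
  refine ⟨∑ e ∈ W.support, Polynomial.aeval (MvPolynomial.X 0) (W.coeff e) *
    Polynomial.aeval (MvPolynomial.X 1) (H e), fun p q hq => ?_⟩
  have hfin := jumpSet_finite hJ hn q
  have heval : ∀ (v : Fin 2 → ℚ) (t : Fin 2) (P : Polynomial ℚ),
      MvPolynomial.eval v (Polynomial.aeval (MvPolynomial.X t) P) = P.eval (v t) := by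
    intro v t P
    rw [Polynomial.aeval_def, Polynomial.hom_eval₂, MvPolynomial.eval_X, Polynomial.eval]
    congr 1
    exact RingHom.ext_rat _ _
  rw [finsum_mem_eq_finite_toFinset_sum _ hfin, map_sum]
  simp only [hW]
  rw [Finset.sum_comm]
  refine Finset.sum_congr rfl fun e _ => ?_
  rw [map_mul, heval, heval, ← Finset.mul_sum, ← finsum_mem_eq_finite_toFinset_sum _ hfin,
    hH e q hq]
  simp

end

/-- for fixed tuples `m ∈ {1,…,ℓ}^{s+1}` and `n ∈ {1,…,ℓ}^{r+1}` there is a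
polynomial `Q ∈ ℚ[X,Y]` with `∑_{c ∈ Ψ_n(q)} |Ψ_m(p;c)| = Q(p,q)` whenever
`p ≥ i^0_ℓ + ⋯ + i^s_ℓ − a_1 j^1_1 − ⋯ − a_r j^r_1 − 1` and `q ≥ j^0_ℓ + ⋯ + j^r_ℓ − 1`. -/
theorem stmt_1 (s r ℓ : ℕ) (hs : 1 ≤ s) (hr : 1 ≤ r) (hl : 1 ≤ ℓ)
    (a : Fin r → ℤ) (ha0 : 0 ≤ a ⟨0, by omega⟩) (hamono : Monotone a)
    (i : Fin (s + 1) → ℕ → ℤ) (hi : ∀ t x, 1 ≤ x → x < ℓ → i t x ≤ i t (x + 1))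
    (j : Fin (r + 1) → ℕ → ℤ) (hj : ∀ u x, 1 ≤ x → x < ℓ → j u x ≤ j u (x + 1))
    (m : Fin (s + 1) → ℕ) (hm : ∀ t, 1 ≤ m t ∧ m t ≤ ℓ)
    (n : Fin (r + 1) → ℕ) (hn : ∀ u, 1 ≤ n u ∧ n u ≤ ℓ) :
    ∃ Q : MvPolynomial (Fin 2) ℚ,
      ∀ p q : ℤ,
        (∑ t : Fin (s + 1), i t ℓ) - (∑ u : Fin r, a u * j u.succ 1) - 1 ≤ p →
        (∑ u : Fin (r + 1), j u ℓ) - 1 ≤ q →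
        (∑ᶠ c ∈ {c : Fin r → ℤ |
            (∑ u, c u) ≤ q - j 0 (n 0) ∧
            (n 0 < ℓ → q - j 0 (n 0 + 1) < ∑ u, c u) ∧
            ∀ u : Fin r, j u.succ (n u.succ) ≤ c u ∧
              (n u.succ < ℓ → c u < j u.succ (n u.succ + 1))},
          (({d : Fin s → ℤ |
            (∑ t, d t) ≤ p + (∑ u, a u * c u) - i 0 (m 0) ∧
            (m 0 < ℓ → p + (∑ u, a u * c u) - i 0 (m 0 + 1) < ∑ t, d t) ∧
            ∀ t : Fin s, i t.succ (m t.succ) ≤ d t ∧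
              (m t.succ < ℓ → d t < i t.succ (m t.succ + 1))}.ncard : ℚ)))
          = MvPolynomial.eval ![(p : ℚ), (q : ℚ)] Q := by
  obtain ⟨f, hf⟩ := exists_eval_ncard_jumpSet hs hi hm
  obtain ⟨Q, hQ⟩ := exists_eval_finsum_jumpSet_comp hr hj hn f a
  refine ⟨Q, fun p q hp hq => ?_⟩
  rw [← hQ p q hq]
  refine finsum_mem_congr rfl fun c hc => hf (p + ∑ u, a u * c u) ?_
  have hac : ∑ u : Fin r, a u * j u.succ 1 ≤ ∑ u : Fin r, a u * c u := by
    refine Finset.sum_le_sum fun u _ => mul_le_mul_of_nonneg_left ?_ ?_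
    · exact (le_of_steps (hj u.succ) le_rfl (hn u.succ).1 (hn u.succ).2).trans (hc.2.2 u).1
    · exact ha0.trans (hamono (Fin.mk_le_of_le_val (Nat.zero_le _)))
  linarith
end

section
/- Fix tuples m ∈ {1,…,ℓ}^{s+1} and n ∈ {1,…,ℓ}^{r+1}. Then there exists a polynomial P ∈ ℚ[X_0, X_1, …, X_r] such that for every integer p with p ≥ i^0_ℓ + ⋯ + i^s_ℓ − a_1·j^1_1 − ⋯ − a_r·j^r_1 − 1 and every c = (c_1,…,c_r) ∈ ℤ^r with c_u ≥ j^u_{n_u} for all u = 1,…,r, the set Ψ_m(p;c) is finite and |Ψ_m(p;c)| = P(p, c_1, …, c_r). -/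
open Polynomial in
/-- Every rational polynomial is the forward difference of a rational polynomial. -/
theorem exists_polynomial_forwardDiff_eq (Q : ℚ[X]) :
    ∃ P : ℚ[X], ∀ x : ℚ, P.eval (x + 1) = P.eval x + Q.eval x := by
  induction Q using Polynomial.induction_on' with
  | add Q₁ Q₂ h₁ h₂ =>
    obtain ⟨P₁, h₁⟩ := h₁
    obtain ⟨P₂, h₂⟩ := h₂
    refine ⟨P₁ + P₂, fun x => ?_⟩
    simp only [eval_add, h₁, h₂]
    ring
  | monomial k c =>
    refine ⟨C (c / (k + 1)) * Polynomial.bernoulli (k + 1), fun x => ?_⟩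
    have hk : (k : ℚ) + 1 ≠ 0 := by positivity
    rw [eval_mul, eval_mul, add_comm x 1, bernoulli_eval_one_add]
    simp only [eval_C, eval_monomial, Nat.add_sub_cancel]
    push_cast
    field_simp

/-- A function on the integers whose forward difference agrees with a polynomial beyond some
bound agrees with a polynomial beyond that bound. -/
theorem exists_polynomial_eq_of_forwardDiff (F : ℤ → ℚ) (Q : Polynomial ℚ) (B : ℤ)
    (h : ∀ x, B ≤ x → F (x + 1) = F x + Q.eval (x : ℚ)) :
    ∃ P : Polynomial ℚ, ∀ x, B ≤ x → F x = P.eval (x : ℚ) := by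
  obtain ⟨P, hP⟩ := exists_polynomial_forwardDiff_eq Q
  refine ⟨P + Polynomial.C (F B - P.eval (B : ℚ)), fun x hx => ?_⟩
  induction x, hx using Int.leInduction with
  | base => simp
  | succ x hx ih =>
    rw [h x hx, ih]
    push_cast
    simp only [Polynomial.eval_add, Polynomial.eval_C, hP]
    ring

/-- The integer vectors with prescribed sum whose coordinates are bounded below by `lo`, and
strictly above by `hi` at the indices satisfying `q`. -/
def boxSlice {k : ℕ} (lo hi : Fin k → ℤ) (q : Fin k → Prop) (x : ℤ) : Set (Fin k → ℤ) :=
  {d | (∀ t, lo t ≤ d t ∧ (q t → d t < hi t)) ∧ ∑ t, d t = x}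

theorem boxSlice_finite {k : ℕ} (lo hi : Fin k → ℤ) (q : Fin k → Prop) (x : ℤ) :
    (boxSlice lo hi q x).Finite := by
  refine (Set.finite_Icc lo (fun t => x - ∑ t, lo t + lo t)).subset ?_
  rintro d ⟨hd, hx⟩
  refine ⟨fun t => (hd t).1, fun t => ?_⟩
  have h := Finset.single_le_sum (f := fun t => d t - lo t)
    (fun t _ => sub_nonneg.2 (hd t).1) (Finset.mem_univ t)
  simp only [Finset.sum_sub_distrib, hx] at h
  linarith

theorem cons_mem_boxSlice {k : ℕ} {lo hi : Fin (k + 1) → ℤ} {q : Fin (k + 1) → Prop} {x y : ℤ}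
    {e : Fin k → ℤ} :
    (Fin.cons y e : Fin (k + 1) → ℤ) ∈ boxSlice lo hi q x ↔
      (lo 0 ≤ y ∧ (q 0 → y < hi 0)) ∧
        e ∈ boxSlice (Fin.tail lo) (Fin.tail hi) (Fin.tail q) (x - y) := by
  simp only [boxSlice, Set.mem_ofPred_eq, Fin.forall_fin_succ, Fin.sum_univ_succ, Fin.cons_zero,
    Fin.cons_succ, Fin.tail, and_assoc, eq_sub_iff_add_eq']

/-- Removing the slice at the lowest value of an unbounded first coordinate leaves a translate. -/
theorem ncard_boxSlice_succ_of_unbounded {k : ℕ} (lo hi : Fin (k + 1) → ℤ)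
    (q : Fin (k + 1) → Prop) (h0 : ¬ q 0) (x : ℤ) :
    (boxSlice lo hi q (x + 1)).ncard = (boxSlice lo hi q x).ncard +
      (boxSlice (Fin.tail lo) (Fin.tail hi) (Fin.tail q) (x + 1 - lo 0)).ncard := by
  set f : (Fin (k + 1) → ℤ) → (Fin (k + 1) → ℤ) := fun d => Fin.cons (d 0 + 1) (Fin.tail d)
  set g : (Fin k → ℤ) → (Fin (k + 1) → ℤ) := fun e => Fin.cons (lo 0) e
  have hf : f.Injective := by
    intro d e h
    obtain ⟨h₁, h₂⟩ := Fin.cons_inj.1 h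
    rw [← Fin.cons_self_tail d, ← Fin.cons_self_tail e, h₂, add_right_cancel h₁]
  have hg : g.Injective := fun d e h => (Fin.cons_inj.1 h).2
  have hU : boxSlice lo hi q (x + 1) = f '' boxSlice lo hi q x ∪
      g '' boxSlice (Fin.tail lo) (Fin.tail hi) (Fin.tail q) (x + 1 - lo 0) := by
    ext d
    obtain ⟨y, e, rfl⟩ : ∃ y e, d = Fin.cons y e := ⟨_, _, (Fin.cons_self_tail d).symm⟩
    simp only [Set.mem_union, Set.mem_image, Fin.exists_fin_succ_pi, cons_mem_boxSlice, f, g,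
      Fin.cons_zero, Fin.tail_cons, Fin.cons_inj, h0, false_imp_iff, and_true]
    constructor
    · rintro ⟨hy, he⟩
      rcases hy.eq_or_lt with rfl | hy
      · exact Or.inr ⟨e, he, rfl, rfl⟩
      · refine Or.inl ⟨y - 1, e, ⟨by omega, ?_⟩, by omega, rfl⟩
        rwa [show x - (y - 1) = x + 1 - y by ring]
    · rintro (⟨z, e', ⟨hz, he⟩, rfl, rfl⟩ | ⟨e', he, rfl, rfl⟩)
      · refine ⟨by omega, ?_⟩
        rwa [show x + 1 - (z + 1) = x - z by ring]
      · exact ⟨le_rfl, he⟩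
  have hdisj : Disjoint (f '' boxSlice lo hi q x)
      (g '' boxSlice (Fin.tail lo) (Fin.tail hi) (Fin.tail q) (x + 1 - lo 0)) := by
    rw [Set.disjoint_left]
    rintro _ ⟨d, hd, rfl⟩ ⟨e, -, he⟩
    have h₁ := (Fin.cons_inj.1 he).1
    have h₂ := (hd.1 0).1
    omega
  rw [hU, Set.ncard_union_eq hdisj ((boxSlice_finite _ _ _ _).image _)
    ((boxSlice_finite _ _ _ _).image _), Set.ncard_image_of_injective _ hf,
    Set.ncard_image_of_injective _ hg]

/-- A slice with bounded first coordinate is the disjoint union of its fibres. -/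
theorem ncard_boxSlice_of_bounded {k : ℕ} (lo hi : Fin (k + 1) → ℤ)
    (q : Fin (k + 1) → Prop) (h0 : q 0) (x : ℤ) :
    (boxSlice lo hi q x).ncard = ∑ y ∈ Finset.Ico (lo 0) (hi 0),
      (boxSlice (Fin.tail lo) (Fin.tail hi) (Fin.tail q) (x - y)).ncard := by
  set F : ℤ → Finset (Fin k → ℤ) := fun y =>
    (boxSlice_finite (Fin.tail lo) (Fin.tail hi) (Fin.tail q) (x - y)).toFinset
  have hF : ∀ y, (boxSlice (Fin.tail lo) (Fin.tail hi) (Fin.tail q) (x - y)).ncard = (F y).card :=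
    fun y => Set.ncard_eq_toFinset_card _ _
  have hinj : Function.Injective
      (fun z : (_ : ℤ) × (Fin k → ℤ) => (Fin.cons z.1 z.2 : Fin (k + 1) → ℤ)) := by
    rintro ⟨y, e⟩ ⟨y', e'⟩ h
    obtain ⟨rfl, rfl⟩ := Fin.cons_inj.1 h
    rfl
  simp only [hF]
  rw [← Finset.card_sigma, ← Set.ncard_coe_finset, ← Set.ncard_image_of_injective _ hinj]
  congr 1
  ext d
  obtain ⟨y, e, rfl⟩ : ∃ y e, d = Fin.cons y e := ⟨_, _, (Fin.cons_self_tail d).symm⟩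
  simp only [cons_mem_boxSlice, Set.mem_image, Finset.mem_coe, Finset.mem_sigma, Finset.mem_Ico,
    Fin.cons_inj, F, Set.Finite.mem_toFinset, Sigma.exists]
  constructor
  · rintro ⟨⟨h₁, h₂⟩, h₃⟩
    exact ⟨y, e, ⟨⟨h₁, h₂ h0⟩, h₃⟩, rfl, rfl⟩
  · rintro ⟨y, e, ⟨⟨h₁, h₂⟩, h₃⟩, rfl, rfl⟩
    exact ⟨⟨h₁, fun _ => h₂⟩, h₃⟩

/-- If `b` dominates the strict upper bounds at the bounded coordinates and the lower bounds at
the unbounded ones, then the number of points of a slice is polynomial in the sum `x` for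
`x > ∑ b - k`. -/
theorem exists_polynomial_ncard_boxSlice {k : ℕ} (lo hi b : Fin k → ℤ) (q : Fin k → Prop)
    (hlo : ∀ t, ¬ q t → lo t ≤ b t) (hhi : ∀ t, q t → hi t ≤ b t) :
    ∃ P : Polynomial ℚ, ∀ x : ℤ, ∑ t, b t - k < x →
      ((boxSlice lo hi q x).ncard : ℚ) = P.eval (x : ℚ) := by
  induction k with
  | zero =>
    refine ⟨0, fun x hx => ?_⟩
    have : boxSlice lo hi q x = ∅ := by
      refine Set.eq_empty_of_forall_notMem fun d hd => ?_
      have := hd.2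
      simp at this hx
      omega
    simp [this]
  | succ k ih =>
    obtain ⟨Q, hQ⟩ := ih (Fin.tail lo) (Fin.tail hi) (Fin.tail b) (Fin.tail q)
      (fun t => hlo t.succ) (fun t => hhi t.succ)
    have hb : ∑ t, b t = b 0 + ∑ t, Fin.tail b t := Fin.sum_univ_succ b
    by_cases h0 : q 0
    · refine ⟨∑ y ∈ Finset.Ico (lo 0) (hi 0), Q.comp (Polynomial.X - Polynomial.C (y : ℚ)),
        fun x hx => ?_⟩
      rw [ncard_boxSlice_of_bounded lo hi q h0, Polynomial.eval_finsetSum]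
      push_cast
      refine Finset.sum_congr rfl fun y hy => ?_
      have hy := (Finset.mem_Ico.1 hy).2
      have := hhi 0 h0
      rw [hQ _ (by push_cast at hx; omega)]
      simp
    · refine (exists_polynomial_eq_of_forwardDiff
        (fun x => ((boxSlice lo hi q x).ncard : ℚ))
        (Q.comp (Polynomial.X + Polynomial.C (1 - lo 0 : ℚ))) (∑ t, b t - k) fun x hx => ?_).imp
          fun P hP x hx => hP x (by push_cast at hx; omega)
      have := hlo 0 h0
      rw [ncard_boxSlice_succ_of_unbounded lo hi q h0, Nat.cast_add, hQ _ (by omega)]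
      simp [add_sub_assoc]

theorem le_of_forall_le_succ_of_le {f : ℕ → ℤ} {l : ℕ}
    (h : ∀ x, 1 ≤ x → x < l → f x ≤ f (x + 1)) {x y : ℕ} (hx : 1 ≤ x) (hxy : x ≤ y)
    (hy : y ≤ l) : f x ≤ f y := by
  induction y, hxy using Nat.le_induction with
  | base => exact le_rfl
  | succ y hxy ih => exact (ih (by omega)).trans (h y (by omega) (by omega))


/-- Lemma 4.6 of the paper: for fixed tuples `m`, `n`, there is a polynomial
`P ∈ ℚ[X_0,…,X_r]` such that for all `p ≥ i^0_ℓ + ⋯ + i^s_ℓ − a_1 j^1_1 − ⋯ − a_r j^r_1 − 1`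
and all `c ∈ ℤ^r` with `c_u ≥ j^u_{n_u}` for all `u`, the set `Ψ_m(p;c)` is finite and
`|Ψ_m(p;c)| = P(p, c_1, …, c_r)`. -/
theorem stmt_2 (s r ℓ : ℕ) (hs : 1 ≤ s) (hr : 1 ≤ r) (hl : 1 ≤ ℓ)
    (a : Fin r → ℤ) (ha0 : 0 ≤ a ⟨0, by omega⟩) (hamono : Monotone a)
    (i : Fin (s + 1) → ℕ → ℤ) (hi : ∀ t x, 1 ≤ x → x < ℓ → i t x ≤ i t (x + 1))
    (j : Fin (r + 1) → ℕ → ℤ) (hj : ∀ u x, 1 ≤ x → x < ℓ → j u x ≤ j u (x + 1))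
    (m : Fin (s + 1) → ℕ) (hm : ∀ t, 1 ≤ m t ∧ m t ≤ ℓ)
    (n : Fin (r + 1) → ℕ) (hn : ∀ u, 1 ≤ n u ∧ n u ≤ ℓ) :
    ∃ P : MvPolynomial (Fin (r + 1)) ℚ,
      ∀ p : ℤ, (∑ t : Fin (s + 1), i t ℓ) - (∑ u : Fin r, a u * j u.succ 1) - 1 ≤ p →
        ∀ c : Fin r → ℤ, (∀ u : Fin r, j u.succ (n u.succ) ≤ c u) →
          Set.Finite {d : Fin s → ℤ |
            (∑ t, d t) ≤ p + (∑ u, a u * c u) - i 0 (m 0) ∧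
            (m 0 < ℓ → p + (∑ u, a u * c u) - i 0 (m 0 + 1) < ∑ t, d t) ∧
            ∀ t : Fin s, i t.succ (m t.succ) ≤ d t ∧
              (m t.succ < ℓ → d t < i t.succ (m t.succ + 1))} ∧
          (({d : Fin s → ℤ |
            (∑ t, d t) ≤ p + (∑ u, a u * c u) - i 0 (m 0) ∧
            (m 0 < ℓ → p + (∑ u, a u * c u) - i 0 (m 0 + 1) < ∑ t, d t) ∧
            ∀ t : Fin s, i t.succ (m t.succ) ≤ d t ∧
              (m t.succ < ℓ → d t < i t.succ (m t.succ + 1))}.ncard : ℚ)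
            = MvPolynomial.eval (Fin.cons (p : ℚ) (fun u => (c u : ℚ))) P) := by
  obtain ⟨P, hP⟩ := exists_polynomial_ncard_boxSlice (fun t => i t (m t))
    (fun t => i t (m t + 1)) (fun t => i t ℓ) (fun t => m t < ℓ)
    (fun t _ => le_of_forall_le_succ_of_le (hi t) (hm t).1 (hm t).2 le_rfl)
    (fun t ht => le_of_forall_le_succ_of_le (hi t) (by omega) ht le_rfl)
  refine ⟨Polynomial.aeval (MvPolynomial.X 0 +
    ∑ u : Fin r, MvPolynomial.C (a u : ℚ) * MvPolynomial.X u.succ) P, fun p hp c hc => ?_⟩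
  set x : ℤ := p + ∑ u, a u * c u with hx
  have hinj : Function.Injective
      (fun d : Fin s → ℤ => (Fin.cons (x - ∑ t, d t) d : Fin (s + 1) → ℤ)) :=
    fun d e h => (Fin.cons_inj.1 h).2
  set S : Set (Fin s → ℤ) := {d | (∑ t, d t) ≤ x - i 0 (m 0) ∧
    (m 0 < ℓ → x - i 0 (m 0 + 1) < ∑ t, d t) ∧
    ∀ t : Fin s, i t.succ (m t.succ) ≤ d t ∧ (m t.succ < ℓ → d t < i t.succ (m t.succ + 1))}
  have hS : (fun d : Fin s → ℤ => (Fin.cons (x - ∑ t, d t) d : Fin (s + 1) → ℤ)) '' S =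
      boxSlice (fun t => i t (m t)) (fun t => i t (m t + 1)) (fun t => m t < ℓ) x := by
    ext d
    obtain ⟨y, e, rfl⟩ : ∃ y e, d = Fin.cons y e := ⟨_, _, (Fin.cons_self_tail d).symm⟩
    rw [cons_mem_boxSlice]
    simp only [Set.mem_image, Fin.cons_inj, S, boxSlice, Set.mem_ofPred_eq, Fin.tail]
    constructor
    · rintro ⟨e, ⟨h₁, h₂, h₃⟩, rfl, rfl⟩
      exact ⟨⟨by omega, fun h => by have := h₂ h; omega⟩, h₃, by omega⟩
    · rintro ⟨⟨h₁, h₂⟩, h₃, h₄⟩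
      exact ⟨e, ⟨by omega, fun h => by have := h₂ h; omega, h₃⟩, by omega, rfl⟩
  have hac : ∑ u, a u * j u.succ 1 ≤ ∑ u, a u * c u := by
    refine Finset.sum_le_sum fun u _ => mul_le_mul_of_nonneg_left ?_ ?_
    · exact (le_of_forall_le_succ_of_le (hj u.succ) le_rfl (hn _).1 (hn _).2).trans (hc u)
    · exact ha0.trans (hamono (Nat.zero_le _))
  refine ⟨.of_finite_image (hS ▸ boxSlice_finite _ _ _ _) hinj.injOn, ?_⟩
  rw [← Set.ncard_image_of_injective S hinj, hS, hP x (by push_cast; omega),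
    Polynomial.aeval_def, Polynomial.hom_eval₂, Polynomial.eval, hx]
  congr 1
  · exact RingHom.ext fun z => by simp
  · simp
end

section
/- Let s ≥ 1 and r ≥ 1 be integers, let 0 ≤ a_1 ≤ ⋯ ≤ a_r be integers, and let λ_0, …, λ_s, μ_0, …, μ_r be integers. Then there exists (d_1, …, d_{s+r}) ∈ ℤ^{s+r} satisfying −d_1 − ⋯ − d_s + a_1d_{s+1} + ⋯ + a_rd_{s+r} ≥ λ_0, d_t ≥ λ_t for t = 1,…,s, −d_{s+1} − ⋯ − d_{s+r} ≥ μ_0, and d_{s+u} ≥ μ_u for u = 1,…,r, if and only if μ_0 + μ_1 + ⋯ + μ_r ≤ 0 and λ_0 + ⋯ + λ_s + a_r·μ_0 + (a_r − a_1)·μ_1 + ⋯ + (a_r − a_{r−1})·μ_{r−1} ≤ 0. -/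
/-- the combined solvability criterion for the system (12) of the paper.
Note `(a_r − a_1)μ_1 + ⋯ + (a_r − a_{r−1})μ_{r−1} = ∑_{u=1}^{r} (a_r − a_u)μ_u` since the
last coefficient vanishes. -/
theorem stmt_10 (s r : ℕ) (hs : 1 ≤ s) (hr : 1 ≤ r) (a : Fin r → ℤ)
    (ha0 : 0 ≤ a ⟨0, by omega⟩) (hamono : Monotone a)
    (lam : Fin (s + 1) → ℤ) (mu : Fin (r + 1) → ℤ) :
    (∃ (d : Fin s → ℤ) (e : Fin r → ℤ),
        lam 0 ≤ -(∑ t, d t) + (∑ u, a u * e u) ∧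
        (∀ t : Fin s, lam t.succ ≤ d t) ∧
        mu 0 ≤ -(∑ u, e u) ∧
        (∀ u : Fin r, mu u.succ ≤ e u))
      ↔ (∑ u : Fin (r + 1), mu u) ≤ 0 ∧
        (∑ t : Fin (s + 1), lam t) + a ⟨r - 1, by omega⟩ * mu 0 +
          (∑ u : Fin r, (a ⟨r - 1, by omega⟩ - a u) * mu u.succ) ≤ 0 := by
  set l : Fin r := ⟨r - 1, by omega⟩ with hl
  have hle : ∀ u, a u ≤ a l := fun u => hamono (by
    rw [Fin.le_def]
    have := u.isLt
    simp only [hl]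
    omega)
  have hl0 : 0 ≤ a l := ha0.trans (hle _)
  rw [Fin.sum_univ_succ mu, Fin.sum_univ_succ lam]
  constructor
  · rintro ⟨d, e, h0, hd, h1, he⟩
    have hsd : ∑ t : Fin s, lam t.succ ≤ ∑ t, d t := Finset.sum_le_sum fun t _ => hd t
    have hse : ∑ u : Fin r, mu u.succ ≤ ∑ u, e u := Finset.sum_le_sum fun u _ => he u
    have hsae : ∑ u : Fin r, (a l - a u) * mu u.succ ≤ ∑ u, (a l - a u) * e u :=
      Finset.sum_le_sum fun u _ => mul_le_mul_of_nonneg_left (he u) (sub_nonneg.2 (hle u))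
    have hexp : ∑ u, (a l - a u) * e u = a l * ∑ u, e u - ∑ u, a u * e u := by
      simp only [sub_mul, Finset.sum_sub_distrib, Finset.mul_sum]
    have hmul := mul_le_mul_of_nonneg_left h1 hl0
    rw [mul_neg] at hmul
    constructor <;> linarith
  · rintro ⟨h1, h2⟩
    set S := mu 0 + ∑ u : Fin r, mu u.succ with hS
    refine ⟨fun t => lam t.succ, fun u => mu u.succ + if u = l then -S else 0, ?_,
      fun _ => le_rfl, ?_, fun u => ?_⟩
    · have hexp : ∑ u : Fin r, (a l - a u) * mu u.succ =
          a l * ∑ u : Fin r, mu u.succ - ∑ u : Fin r, a u * mu u.succ := by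
        simp only [sub_mul, Finset.sum_sub_distrib, Finset.mul_sum]
      have hmul : a l * S = a l * mu 0 + a l * ∑ u : Fin r, mu u.succ := by rw [hS, mul_add]
      simp only [mul_add, Finset.sum_add_distrib, mul_ite, mul_zero, Finset.sum_ite_eq',
        Finset.mem_univ, if_true, mul_neg]
      linarith
    · simp only [Finset.sum_add_distrib, Finset.sum_ite_eq', Finset.mem_univ, if_true]
      linarith
    · dsimp only
      split_ifs <;> linarith
end

section
/- Suppose there exist integers p, q and a tuple (d_1,…,d_s, e_1,…,e_r) ∈ ℤ^s × ℤ^r such that F^0(p − d_1 − ⋯ − d_s + a_1e_1 + ⋯ + a_re_r) ∩ F^1(d_1) ∩ ⋯ ∩ F^s(d_s) ∩ G^0(q − e_1 − ⋯ − e_r) ∩ G^1(e_1) ∩ ⋯ ∩ G^r(e_r) ≠ 0. Then q ≥ j^0_1 + j^1_1 + ⋯ + j^r_1 and p + a_r·q ≥ i^0_1 + ⋯ + i^s_1 + a_r·j^0_1 + (a_r − a_1)·j^1_1 + ⋯ + (a_r − a_{r−1})·j^{r−1}_1. -/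
/-- if some graded piece of the saturation is nonzero, i.e. some intersection
`F^0(p−Σd+Σa·e) ∩ F^1(d_1) ∩ ⋯ ∩ F^s(d_s) ∩ G^0(q−Σe) ∩ G^1(e_1) ∩ ⋯ ∩ G^r(e_r) ≠ 0`,
then `q ≥ j^0_1 + ⋯ + j^r_1` and
`p + a_r q ≥ i^0_1 + ⋯ + i^s_1 + a_r j^0_1 + (a_r−a_1) j^1_1 + ⋯ + (a_r−a_{r−1}) j^{r−1}_1`
(the last sum is written as `∑_{u=1}^{r} (a_r − a_u) j^u_1` since its `u = r` term vanishes). -/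
theorem stmt_11 (s r ℓ : ℕ) (hs : 1 ≤ s) (hr : 1 ≤ r) (hl : 1 ≤ ℓ)
    (a : Fin r → ℤ) (ha0 : 0 ≤ a ⟨0, by omega⟩) (hamono : Monotone a)
    (i : Fin (s + 1) → ℕ → ℤ) (hi : ∀ t x, 1 ≤ x → x < ℓ → i t x ≤ i t (x + 1))
    (j : Fin (r + 1) → ℕ → ℤ) (hj : ∀ u x, 1 ≤ x → x < ℓ → j u x ≤ j u (x + 1))
    (Fc : Fin (s + 1) → ℕ → Submodule ℂ (Fin ℓ → ℂ))
    (hFc : ∀ t x, 1 ≤ x → x < ℓ → Fc t x ≤ Fc t (x + 1)) (hFctop : ∀ t, Fc t ℓ = ⊤)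
    (Gc : Fin (r + 1) → ℕ → Submodule ℂ (Fin ℓ → ℂ))
    (hGc : ∀ u x, 1 ≤ x → x < ℓ → Gc u x ≤ Gc u (x + 1)) (hGctop : ∀ u, Gc u ℓ = ⊤)
    (F : Fin (s + 1) → ℤ → Submodule ℂ (Fin ℓ → ℂ))
    (G : Fin (r + 1) → ℤ → Submodule ℂ (Fin ℓ → ℂ))
    (hFbot : ∀ t k, k < i t 1 → F t k = ⊥)
    (hFmid : ∀ t x, 1 ≤ x → x < ℓ → ∀ k, i t x ≤ k → k < i t (x + 1) → F t k = Fc t x)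
    (hFtop : ∀ t k, i t ℓ ≤ k → F t k = ⊤)
    (hGbot : ∀ u k, k < j u 1 → G u k = ⊥)
    (hGmid : ∀ u x, 1 ≤ x → x < ℓ → ∀ k, j u x ≤ k → k < j u (x + 1) → G u k = Gc u x)
    (hGtop : ∀ u k, j u ℓ ≤ k → G u k = ⊤)
    (p q : ℤ)
    (hne : ∃ (d : Fin s → ℤ) (e : Fin r → ℤ),
        F 0 (p - (∑ t, d t) + (∑ u, a u * e u)) ⊓ (⨅ t : Fin s, F t.succ (d t)) ⊓
          G 0 (q - ∑ u, e u) ⊓ (⨅ u : Fin r, G u.succ (e u)) ≠ ⊥) :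
    (∑ u : Fin (r + 1), j u 1) ≤ q ∧
    (∑ t : Fin (s + 1), i t 1) + a ⟨r - 1, by omega⟩ * j 0 1 +
        (∑ u : Fin r, (a ⟨r - 1, by omega⟩ - a u) * j u.succ 1)
      ≤ p + a ⟨r - 1, by omega⟩ * q := by
  obtain ⟨d, e, hne⟩ := hne
  have hF0 : i 0 1 ≤ p - (∑ t, d t) + (∑ u, a u * e u) := by
    by_contra! h
    exact hne (by simp [hFbot 0 _ h])
  have hG0 : j 0 1 ≤ q - ∑ u, e u := by
    by_contra! h
    exact hne (by simp [hGbot 0 _ h])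
  have hF (t : Fin s) : i t.succ 1 ≤ d t := by
    by_contra! h
    have hbot : (⨅ t : Fin s, F t.succ (d t)) = ⊥ :=
      eq_bot_iff.2 ((iInf_le _ t).trans (hFbot _ _ h).le)
    exact hne (by simp [hbot])
  have hG (u : Fin r) : j u.succ 1 ≤ e u := by
    by_contra! h
    have hbot : (⨅ u : Fin r, G u.succ (e u)) = ⊥ :=
      eq_bot_iff.2 ((iInf_le _ u).trans (hGbot _ _ h).le)
    exact hne (by simp [hbot])
  have hle (u : Fin r) : a u ≤ a ⟨r - 1, by omega⟩ :=
    hamono (Fin.le_def.2 (Nat.le_sub_one_of_lt u.2))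
  have hlast : 0 ≤ a ⟨r - 1, by omega⟩ := ha0.trans (hle _)
  generalize a ⟨r - 1, by omega⟩ = A at hle hlast ⊢
  have hsumF : ∑ t : Fin s, i t.succ 1 ≤ ∑ t, d t := Finset.sum_le_sum fun t _ => hF t
  have hsumG : ∑ u : Fin r, j u.succ 1 ≤ ∑ u, e u := Finset.sum_le_sum fun u _ => hG u
  have hweighted : ∑ u : Fin r, (A - a u) * j u.succ 1 ≤ A * ∑ u, e u - ∑ u, a u * e u := by
    rw [Finset.mul_sum, ← Finset.sum_sub_distrib]
    refine Finset.sum_le_sum fun u _ => ?_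
    rw [← sub_mul]
    exact mul_le_mul_of_nonneg_left (hG u) (sub_nonneg.2 (hle u))
  have hA := mul_le_mul_of_nonneg_left hG0 hlast
  rw [mul_sub] at hA
  rw [Fin.sum_univ_succ, Fin.sum_univ_succ]
  constructor <;> linarith
end

section
/- Assume in addition that F^t_1 ≠ 0 for every t = 0,…,s and G^u_1 ≠ 0 for every u = 0,…,r. Suppose (p,q) ∈ ℤ² satisfies either (a) for some k ∈ {0,…,s}: q ≥ j^0_ℓ + j^1_ℓ + ⋯ + j^r_ℓ and p + a_r·q ≥ (i^0_ℓ + ⋯ + i^s_ℓ) − (i^k_ℓ − i^k_1) + a_r·j^0_ℓ + (a_r − a_1)·j^1_ℓ + ⋯ + (a_r − a_{r−1})·j^{r−1}_ℓ; or (b) for some k ∈ {0,…,r}: q ≥ (j^0_ℓ + j^1_ℓ + ⋯ + j^r_ℓ) − (j^k_ℓ − j^k_1) and p + a_r·q ≥ i^0_ℓ + ⋯ + i^s_ℓ + a_r·j^0_ℓ + (a_r − a_1)·j^1_ℓ + ⋯ + (a_r − a_{r−1})·j^{r−1}_ℓ − c_k·(j^k_ℓ − j^k_1), where c_0 := a_r,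 c_u := a_r − a_u for 1 ≤ u ≤ r−1, and c_r := 0. Then there exists a tuple (d_1,…,d_s, e_1,…,e_r) ∈ ℤ^s × ℤ^r such that F^0(p − d_1 − ⋯ − d_s + a_1e_1 + ⋯ + a_re_r) ∩ F^1(d_1) ∩ ⋯ ∩ F^s(d_s) ∩ G^0(q − e_1 − ⋯ − e_r) ∩ G^1(e_1) ∩ ⋯ ∩ G^r(e_r) ≠ 0. -/
/-- A filtration with jumps `i 1 ≤ ⋯ ≤ i ℓ` contains its `x`-th step from the `x`-th jump on. -/
theorem chain_le_filtration {M : Type*} [AddCommGroup M] [Module ℂ M] {ℓ : ℕ} {i : ℕ → ℤ}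
    {C : ℕ → Submodule ℂ M} (hC : ∀ x, 1 ≤ x → x < ℓ → C x ≤ C (x + 1))
    {F : ℤ → Submodule ℂ M}
    (hmid : ∀ x, 1 ≤ x → x < ℓ → ∀ k, i x ≤ k → k < i (x + 1) → F k = C x)
    (htop : ∀ k, i ℓ ≤ k → F k = ⊤) {x : ℕ} (hx : 1 ≤ x) (hxl : x ≤ ℓ) {k : ℤ}
    (hk : i x ≤ k) : C x ≤ F k := by
  induction hxl using Nat.decreasingInduction with
  | self => simp [htop k hk]
  | of_succ x hlt ih =>
    rcases lt_or_ge k (i (x + 1)) with h | h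
    · exact (hmid x hx hlt k hk h).ge
    · exact (hC x hx hlt).trans (ih (by omega) h)

/-- If a nonzero subspace `W` lies in every `F t` from `I t` on and in every `G u` from `J u` on,
then some graded piece of the saturation in degree `(p, q)` contains `W`, provided `(p, q)`
satisfies the bounds given by `I` and `J`. -/
theorem exists_inf_ne_bot_of_le {M : Type*} [AddCommGroup M] [Module ℂ M] {s r : ℕ}
    (a : Fin r → ℤ) (m : Fin r) {F : Fin (s + 1) → ℤ → Submodule ℂ M}
    {G : Fin (r + 1) → ℤ → Submodule ℂ M} {W : Submodule ℂ M} (hW : W ≠ ⊥)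
    {I : Fin (s + 1) → ℤ} {J : Fin (r + 1) → ℤ}
    (hF : ∀ t k, I t ≤ k → W ≤ F t k) (hG : ∀ u k, J u ≤ k → W ≤ G u k) {p q : ℤ}
    (hq : ∑ u, J u ≤ q)
    (hp : ∑ t, I t + a m * J 0 + ∑ u, (a m - a u) * J u.succ ≤ p + a m * q) :
    ∃ (d : Fin s → ℤ) (e : Fin r → ℤ),
      F 0 (p - (∑ t, d t) + (∑ u, a u * e u)) ⊓ (⨅ t : Fin s, F t.succ (d t)) ⊓
        G 0 (q - ∑ u, e u) ⊓ (⨅ u : Fin r, G u.succ (e u)) ≠ ⊥ := by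
  rw [Fin.sum_univ_succ] at hq hp
  let δ : ℤ := q - J 0 - ∑ u : Fin r, J u.succ
  let e : Fin r → ℤ := fun u => J u.succ + if u = m then δ else 0
  have hδ : 0 ≤ δ := by simp only [δ]; linarith
  have hesum : ∑ u, e u = q - J 0 := by
    simp [e, δ, Finset.sum_add_distrib]
  have haesum : ∑ u, a u * e u = a m * (q - J 0) - ∑ u, (a m - a u) * J u.succ := by
    simp only [e, δ, mul_add, sub_mul, mul_ite, mul_zero, Finset.sum_add_distrib,
      Finset.sum_sub_distrib, Finset.sum_ite_eq', Finset.mem_univ, if_true, ← Finset.mul_sum]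
    ring
  refine ⟨fun t => I t.succ, e, ne_bot_of_le_ne_bot hW ?_⟩
  refine le_inf (le_inf (le_inf (hF _ _ ?_) (le_iInf fun t => hF _ _ le_rfl)) (hG _ _ ?_))
    (le_iInf fun u => hG _ _ ?_)
  · rw [haesum]; linarith
  · rw [hesum]; linarith
  · simp only [e]; split_ifs <;> linarith


/-- if the chains satisfy `F^t_1 ≠ 0`, `G^u_1 ≠ 0` and `(p,q)` lies in one of
the regions `I(k)` (condition (a)) or `J(k)` (condition (b)), then some graded piece of the
saturation is nonzero, i.e. some intersection
`F^0(p−Σd+Σa·e) ∩ F^1(d_1) ∩ ⋯ ∩ F^s(d_s) ∩ G^0(q−Σe) ∩ G^1(e_1) ∩ ⋯ ∩ G^r(e_r) ≠ 0`.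
Sums of the form `(a_r−a_1)j^1_ℓ + ⋯ + (a_r−a_{r−1})j^{r−1}_ℓ` are written as
`∑_{u=1}^{r} (a_r − a_u) j^u_ℓ` (the `u = r` term vanishes), and the coefficients
`c_0 = a_r`, `c_u = a_r − a_u` (`1 ≤ u ≤ r−1`), `c_r = 0` are encoded by
`Fin.cases a_r (fun u => a_r − a_u)`. -/
theorem stmt_12 (s r ℓ : ℕ) (hs : 1 ≤ s) (hr : 1 ≤ r) (hl : 1 ≤ ℓ)
    (a : Fin r → ℤ) (ha0 : 0 ≤ a ⟨0, by omega⟩) (hamono : Monotone a)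
    (i : Fin (s + 1) → ℕ → ℤ) (hi : ∀ t x, 1 ≤ x → x < ℓ → i t x ≤ i t (x + 1))
    (j : Fin (r + 1) → ℕ → ℤ) (hj : ∀ u x, 1 ≤ x → x < ℓ → j u x ≤ j u (x + 1))
    (Fc : Fin (s + 1) → ℕ → Submodule ℂ (Fin ℓ → ℂ))
    (hFc : ∀ t x, 1 ≤ x → x < ℓ → Fc t x ≤ Fc t (x + 1)) (hFctop : ∀ t, Fc t ℓ = ⊤)
    (Gc : Fin (r + 1) → ℕ → Submodule ℂ (Fin ℓ → ℂ))
    (hGc : ∀ u x, 1 ≤ x → x < ℓ → Gc u x ≤ Gc u (x + 1)) (hGctop : ∀ u, Gc u ℓ = ⊤)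
    (hFc1 : ∀ t, Fc t 1 ≠ ⊥) (hGc1 : ∀ u, Gc u 1 ≠ ⊥)
    (F : Fin (s + 1) → ℤ → Submodule ℂ (Fin ℓ → ℂ))
    (G : Fin (r + 1) → ℤ → Submodule ℂ (Fin ℓ → ℂ))
    (hFbot : ∀ t k, k < i t 1 → F t k = ⊥)
    (hFmid : ∀ t x, 1 ≤ x → x < ℓ → ∀ k, i t x ≤ k → k < i t (x + 1) → F t k = Fc t x)
    (hFtop : ∀ t k, i t ℓ ≤ k → F t k = ⊤)
    (hGbot : ∀ u k, k < j u 1 → G u k = ⊥)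
    (hGmid : ∀ u x, 1 ≤ x → x < ℓ → ∀ k, j u x ≤ k → k < j u (x + 1) → G u k = Gc u x)
    (hGtop : ∀ u k, j u ℓ ≤ k → G u k = ⊤)
    (p q : ℤ)
    (hpq :
      (∃ k : Fin (s + 1),
        (∑ u : Fin (r + 1), j u ℓ) ≤ q ∧
        (∑ t : Fin (s + 1), i t ℓ) - (i k ℓ - i k 1) + a ⟨r - 1, by omega⟩ * j 0 ℓ +
            (∑ u : Fin r, (a ⟨r - 1, by omega⟩ - a u) * j u.succ ℓ)
          ≤ p + a ⟨r - 1, by omega⟩ * q) ∨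
      (∃ k : Fin (r + 1),
        (∑ u : Fin (r + 1), j u ℓ) - (j k ℓ - j k 1) ≤ q ∧
        (∑ t : Fin (s + 1), i t ℓ) + a ⟨r - 1, by omega⟩ * j 0 ℓ +
            (∑ u : Fin r, (a ⟨r - 1, by omega⟩ - a u) * j u.succ ℓ) -
            (Fin.cases (a ⟨r - 1, by omega⟩)
              (fun u : Fin r => a ⟨r - 1, by omega⟩ - a u) k) * (j k ℓ - j k 1)
          ≤ p + a ⟨r - 1, by omega⟩ * q)) :
    ∃ (d : Fin s → ℤ) (e : Fin r → ℤ),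
      F 0 (p - (∑ t, d t) + (∑ u, a u * e u)) ⊓ (⨅ t : Fin s, F t.succ (d t)) ⊓
        G 0 (q - ∑ u, e u) ⊓ (⨅ u : Fin r, G u.succ (e u)) ≠ ⊥ := by
  have hFle t {x : ℕ} (hx : 1 ≤ x) (hxl : x ≤ ℓ) {k : ℤ} (hk : i t x ≤ k) : Fc t x ≤ F t k :=
    chain_le_filtration (hFc t) (hFmid t) (hFtop t) hx hxl hk
  have hGle u {x : ℕ} (hx : 1 ≤ x) (hxl : x ≤ ℓ) {k : ℤ} (hk : j u x ≤ k) : Gc u x ≤ G u k :=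
    chain_le_filtration (hGc u) (hGmid u) (hGtop u) hx hxl hk
  rcases hpq with ⟨k, hq, hp⟩ | ⟨k, hq, hp⟩
  · refine exists_inf_ne_bot_of_le a ⟨r - 1, by omega⟩ (hFc1 k)
      (I := fun t => i t ℓ - if t = k then i k ℓ - i k 1 else 0) (J := fun u => j u ℓ)
      (fun t x hx => ?_) (fun u x hx => by simp [hGtop u x hx]) hq ?_
    · split_ifs at hx with h
      · subst h
        exact hFle t le_rfl hl (by linarith)
      · simp [hFtop t x (by linarith)]
    · simpa [Finset.sum_sub_distrib] using hp
  · refine exists_inf_ne_bot_of_le a ⟨r - 1, by omega⟩ (hGc1 k)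
      (I := fun t => i t ℓ) (J := fun u => j u ℓ - if u = k then j k ℓ - j k 1 else 0)
      (fun t x hx => by simp [hFtop t x hx]) (fun u x hx => ?_) ?_ ?_
    · split_ifs at hx with h
      · subst h
        exact hGle u le_rfl hl (by linarith)
      · simp [hGtop u x (by linarith)]
    · simpa [Finset.sum_sub_distrib] using hq
    · cases k using Fin.cases with
      | zero =>
        simp only [Fin.cases_zero, Fin.succ_ne_zero, if_true, if_false, sub_zero] at hp ⊢
        linarith
      | succ v =>
        simp only [Fin.cases_succ, Fin.succ_inj, (Fin.succ_ne_zero v).symm, if_false, sub_zero,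
          mul_sub (_ - _), mul_ite, mul_zero, Finset.sum_sub_distrib, Finset.sum_ite_eq',
          Finset.mem_univ, if_true] at hp ⊢
        linarith
end

section
/- Let G be an abelian group, R a commutative ring, A a commutative R-algebra, and 𝒜 : G → Submodule_R A an internal G-grading of A (the family (𝒜_g)_{g∈G} is independent with supremum all of A, and 𝒜_g · 𝒜_{g'} ⊆ 𝒜_{g+g'}). Let f ∈ A be homogeneous of degree d, i.e. f ∈ 𝒜_d. For each g ∈ G, let B_g be the R-submodule of the localization A_f of A away from f consisting of all fractions a/f^n with n ∈ ℕ and a ∈ 𝒜_{g + n·d}. Then the family (B_g)_{g∈G} is independent, its supremum is all of A_f, and B_g · B_{g'} ⊆ B_{g+g'} for all g, g' ∈ G; that is, the B_g structure A_f as a G-graded R-algebra. -/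
section GradedAway

variable {G R A : Type*} [AddCommGroup G] [CommRing R] [CommRing A] [Algebra R A]
  {𝒜 : G → Submodule R A}

lemma mul_pow_mem_of_homogeneous
    (hmul : ∀ g g' : G, ∀ x ∈ 𝒜 g, ∀ y ∈ 𝒜 g', x * y ∈ 𝒜 (g + g'))
    {d : G} {f : A} (hf : f ∈ 𝒜 d) {g : G} {a : A} (ha : a ∈ 𝒜 g) (n : ℕ) :
    a * f ^ n ∈ 𝒜 (g + n • d) := by
  induction n with
  | zero => simpa using ha
  | succ k ih =>
    rw [pow_succ, ← mul_assoc, succ_nsmul, ← add_assoc]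
    exact hmul _ _ _ ih _ hf

lemma eventually_exists_mk_mul_pow_eq
    (hmul : ∀ g g' : G, ∀ x ∈ 𝒜 g, ∀ y ∈ 𝒜 g', x * y ∈ 𝒜 (g + g'))
    {d : G} {f : A} (hf : f ∈ 𝒜 d) {g : G} {n : ℕ} {a : A} (ha : a ∈ 𝒜 (g + n • d)) :
    ∀ᶠ N : ℕ in Filter.atTop, ∃ b ∈ 𝒜 (g + N • d),
      (Localization.mk a ⟨f ^ n, n, rfl⟩ : Localization.Away f) *
        algebraMap A (Localization.Away f) f ^ N = algebraMap A (Localization.Away f) b := by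
  filter_upwards [Filter.eventually_ge_atTop n] with N hN
  obtain ⟨k, rfl⟩ := Nat.exists_eq_add_of_le hN
  refine ⟨a * f ^ k, ?_, ?_⟩
  · rw [add_nsmul, ← add_assoc]
    exact mul_pow_mem_of_homogeneous hmul hf ha k
  · rw [Localization.mk_eq_mk', ← map_pow, mul_comm, IsLocalization.mul_mk'_eq_mk'_of_mul,
      IsLocalization.mk'_eq_iff_eq_mul, ← map_mul]
    congr 1
    ring

lemma iSupIndep_away (hindep : iSupIndep 𝒜)
    (hmul : ∀ g g' : G, ∀ x ∈ 𝒜 g, ∀ y ∈ 𝒜 g', x * y ∈ 𝒜 (g + g'))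
    {d : G} {f : A} (hf : f ∈ 𝒜 d) {B : G → Submodule R (Localization.Away f)}
    (hB : ∀ g, ∀ z ∈ B g, ∃ (n : ℕ) (a : A), a ∈ 𝒜 (g + n • d) ∧
      z = (Localization.mk a ⟨f ^ n, n, rfl⟩ : Localization.Away f)) :
    iSupIndep B := by
  classical
  rw [iSupIndep_iff_finsetSum_eq_zero_imp_eq_zero]
  intro s v hv hsum
  have hev : ∀ᶠ N : ℕ in Filter.atTop, ∀ i ∈ s, ∃ b ∈ 𝒜 (i + N • d),
      v i * algebraMap A (Localization.Away f) f ^ N =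
        algebraMap A (Localization.Away f) b := by
    rw [Filter.eventually_all_finset]
    intro i hi
    obtain ⟨n, a, ha, hz⟩ := hB i _ (hv i hi)
    rw [hz]
    exact eventually_exists_mk_mul_pow_eq hmul hf ha
  obtain ⟨N, hN⟩ := hev.exists
  choose! b hb hvb using hN
  have hb_sum : algebraMap A (Localization.Away f) (∑ i ∈ s, b i) = algebraMap A _ 0 := by
    rw [map_sum, map_zero, ← Finset.sum_congr rfl hvb, ← Finset.sum_mul, hsum, zero_mul]
  obtain ⟨k, hk⟩ := IsLocalization.Away.exists_of_eq f hb_sum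
  rw [mul_zero, mul_comm, Finset.sum_mul] at hk
  have hshift : iSupIndep fun i => 𝒜 (i + (N + k) • d) :=
    hindep.comp (add_left_injective ((N + k) • d))
  rw [iSupIndep_iff_finsetSum_eq_zero_imp_eq_zero] at hshift
  have hzero := hshift s (fun i => b i * f ^ k) (fun i hi => by
    rw [add_nsmul, ← add_assoc]
    exact mul_pow_mem_of_homogeneous hmul hf (hb i hi) k) hk
  intro i hi
  have hu := IsLocalization.Away.algebraMap_pow_isUnit (S := Localization.Away f) f (N + k)
  rw [← hu.mul_left_eq_zero, pow_add, ← mul_assoc, hvb i hi, ← map_pow, ← map_mul, hzero i hi,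
    map_zero]

lemma iSup_away_eq_top (hsup : (⨆ g : G, 𝒜 g) = ⊤)
    {d : G} {f : A} {B : G → Submodule R (Localization.Away f)}
    (hB : ∀ (g : G) (n : ℕ), ∀ a ∈ 𝒜 (g + n • d),
      (Localization.mk a ⟨f ^ n, n, rfl⟩ : Localization.Away f) ∈ B g) :
    (⨆ g : G, B g) = ⊤ := by
  rw [eq_top_iff]
  rintro z -
  induction z using Localization.induction_on with | H y =>
  obtain ⟨a, ⟨_, n, rfl⟩⟩ := y
  have ha : a ∈ ⨆ g, 𝒜 g := hsup ▸ Submodule.mem_top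
  induction ha using Submodule.iSup_induction' with
  | mem g a ha =>
    exact Submodule.mem_iSup_of_mem (g - n • d) (hB _ n a (by rwa [sub_add_cancel]))
  | zero =>
    rw [Localization.mk_zero]
    exact zero_mem _
  | add a b _ _ iha ihb =>
    rw [← Localization.add_mk_self]
    exact add_mem iha ihb

end GradedAway


/-- Lemma 2.2 of the paper: if `𝒜` is an internal `G`-grading of a
commutative `R`-algebra `A` and `f ∈ 𝒜_d` is homogeneous of degree `d`, then the
submodules `B_g` of the localization `A_f` consisting of all fractions `a / fⁿ` with
`a ∈ 𝒜_{g + n·d}` form an internal `G`-grading of `A_f` as an `R`-algebra. -/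
theorem stmt_14 (G : Type*) [AddCommGroup G]
    (R A : Type*) [CommRing R] [CommRing A] [Algebra R A]
    (𝒜 : G → Submodule R A)
    (hindep : iSupIndep 𝒜) (hsup : (⨆ g : G, 𝒜 g) = ⊤)
    (hmul : ∀ g g' : G, ∀ x ∈ 𝒜 g, ∀ y ∈ 𝒜 g', x * y ∈ 𝒜 (g + g'))
    (d : G) (f : A) (hf : f ∈ 𝒜 d)
    (B : G → Submodule R (Localization.Away f))
    (hB : ∀ (g : G) (z : Localization.Away f),
      z ∈ B g ↔ ∃ (n : ℕ) (a : A), a ∈ 𝒜 (g + n • d) ∧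
        z = (Localization.mk a ⟨f ^ n, n, rfl⟩ : Localization.Away f)) :
    iSupIndep B ∧ (⨆ g : G, B g) = ⊤ ∧
      ∀ g g' : G, ∀ z ∈ B g, ∀ w ∈ B g', z * w ∈ B (g + g') := by
  refine ⟨iSupIndep_away hindep hmul hf fun g z hz => (hB g z).1 hz,
    iSup_away_eq_top hsup fun g n a ha => (hB g _).2 ⟨n, a, ha, rfl⟩, ?_⟩
  intro g g' z hz w hw
  obtain ⟨n, a, ha, rfl⟩ := (hB g z).1 hz
  obtain ⟨m, b, hb, rfl⟩ := (hB g' w).1 hw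
  refine (hB _ _).2 ⟨n + m, a * b, ?_, ?_⟩
  · rw [add_nsmul, add_add_add_comm]
    exact hmul _ _ _ ha _ hb
  · rw [Localization.mk_mul]
    congr 1
    exact Subtype.ext (pow_add f n m).symm
end
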